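/- arXiv:2407.20994 — 4 statements merged into one kernel-verified Lean document; each statement's English description precedes it below -/
import Mathlib

section
/- Let α > −1 and, for each n ≥ 0, let ℓ_n^{(α)} be the monic degree-n polynomial with ∫_0^∞ ℓ_n^{(α)}(x) x^k e^{−x} x^α dx = 0 for 0 ≤ k < n (with the convention ℓ_{−1}^{(α)} = 0). Let w₁(x) = e^{−x} x^α·[[x(1+x), x],[x, 1]] and w₂(x) = e^{−x} x^α·[[1 + x², x],[x, 1]] on (0,∞). Then P_{1,n}(x) = [[ℓ_n^{(α+1)}(x), −(n+α+1)ℓ_n^{(α)}(x)],[−n ℓ_{n−1}^{(α+1)}(x), n x ℓ_{n−1}^{(α+1)}(x) + ℓ_n^{(α)}(x)]] is a sequence of matrix orthogonal polynomials with respect to w₁, and P_{2,n}(x) = [[ℓ_n^{(α)}(x), ℓ_{n+1}^{(α)}(x) − x ℓ_n^{(α)}(x)],[−n(n+α) ℓ_{n−1}^{(α)}(x), n(n+α) x ℓ_{n−1}^{(α)}(x) + ℓ_n^{(α)}(x)]] is a sequence of matrix orthogonal polynomials with respect to w₂. -/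
open MeasureTheory Filter Polynomial Matrix
open scoped ComplexOrder

noncomputable section

/-- A matrix polynomial. -/
abbrev MatPoly (n m : ℕ) := Matrix (Fin n) (Fin m) (Polynomial ℂ)

/-- Evaluation of a matrix polynomial at a real point. -/
def evalM {n m : ℕ} (P : MatPoly n m) (x : ℝ) : Matrix (Fin n) (Fin m) ℂ :=
  Matrix.of fun i j => (P i j).eval (x : ℂ)

/-- Entrywise `j`-th derivative of a matrix polynomial. -/
def derivM {n m : ℕ} (j : ℕ) (P : MatPoly n m) : MatPoly n m :=
  Matrix.of fun i k => (⇑Polynomial.derivative)^[j] (P i k)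

/-- A constant matrix, viewed as a matrix polynomial. -/
def cmap {n m : ℕ} (A : Matrix (Fin n) (Fin m) ℂ) : MatPoly n m :=
  A.map Polynomial.C

/-- A matrix differential operator with polynomial coefficients,
`D = ∑_{j ≤ order} ∂^j F_j`, acting on the right. -/
structure MatDiffOp (n m : ℕ) where
  order : ℕ
  coeff : ℕ → MatPoly n m
  coeff_eq_zero : ∀ j, order < j → coeff j = 0

/-- The right action `(P · D)(x) = ∑_j P^{(j)}(x) F_j(x)`. -/
def MatDiffOp.act {k n m : ℕ} (P : MatPoly k n) (D : MatDiffOp n m) : MatPoly k m :=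
  ∑ j ∈ Finset.range (D.order + 1), derivM j P * D.coeff j

/-- The action `f · D = ∑_j f^{(j)} F_j` on a scalar polynomial. -/
def MatDiffOp.sact {n m : ℕ} (D : MatDiffOp n m) (f : Polynomial ℂ) : MatPoly n m :=
  ∑ j ∈ Finset.range (D.order + 1), ((⇑Polynomial.derivative)^[j] f) • D.coeff j

/-- A weight matrix on the set `s`: smooth, a.e. positive definite, with finite moments. -/
structure IsWeight (s : Set ℝ) {N : ℕ} (W : ℝ → Matrix (Fin N) (Fin N) ℂ) : Prop where
  smooth : ∀ i j, ContDiffOn ℝ (⊤ : ℕ∞) (fun x => W x i j) s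
  posdef : ∀ᵐ x ∂(volume.restrict s), (W x).PosDef
  moments : ∀ (k : ℕ) (i j : Fin N), IntegrableOn (fun x : ℝ => (x : ℂ) ^ k * W x i j) s

/-- `∑_j W^{(j)}(x) F_j(x)` for a differential operator `D` with coefficients `F_j`. -/
def weightSide {N : ℕ} (W : ℝ → Matrix (Fin N) (Fin N) ℂ) (D : MatDiffOp N N) (x : ℝ) :
    Matrix (Fin N) (Fin N) ℂ :=
  ∑ j ∈ Finset.range (D.order + 1),
    (Matrix.of fun i k => iteratedDeriv j (fun t => W t i k) x) * evalM (D.coeff j) x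

/-- The weight `W` is good enough. -/
def GoodEnough (s : Set ℝ) {N : ℕ} (W : ℝ → Matrix (Fin N) (Fin N) ℂ) : Prop :=
  ∀ (A : MatPoly N N) (D : MatDiffOp N N),
    (∀ (P : MatPoly N N) (i j : Fin N),
        IntegrableOn (fun x => (evalM P x * (evalM A x * W x)) i j) s ∧
        IntegrableOn (fun x => (evalM P x * weightSide W D x) i j) s ∧
        ∫ x in s, (evalM P x * (evalM A x * W x)) i j =
          ∫ x in s, (evalM P x * weightSide W D x) i j) →
    ∀ x ∈ s, evalM A x * W x = weightSide W D x

/-- The matrix inner product `⟨P, Q⟩_W = ∫ P W Q^*`. -/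
def innerW (s : Set ℝ) {N a b : ℕ} (W : ℝ → Matrix (Fin N) (Fin N) ℂ)
    (P : MatPoly a N) (Q : MatPoly b N) : Matrix (Fin a) (Fin b) ℂ :=
  Matrix.of fun i j => ∫ x in s, (evalM P x * W x * (evalM Q x)ᴴ) i j

/-- A sequence of matrix orthogonal polynomials with respect to `W` on `s`. -/
structure IsMOP (s : Set ℝ) {N : ℕ} (W : ℝ → Matrix (Fin N) (Fin N) ℂ)
    (P : ℕ → MatPoly N N) : Prop where
  degree_le : ∀ n (i j : Fin N), ((P n) i j).natDegree ≤ n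
  lead_unit : ∀ n, IsUnit (Matrix.of fun i j : Fin N => ((P n) i j).coeff n)
  integrable : ∀ n m (i j : Fin N),
    IntegrableOn (fun x => (evalM (P n) x * W x * (evalM (P m) x)ᴴ) i j) s
  orthogonal : ∀ n m, n ≠ m → innerW s W (P n) (P m) = 0

/-- Membership in the algebra `𝒟(W)` (relative to the MOP sequence `P`). -/
def InDW {N : ℕ} (P : ℕ → MatPoly N N) (D : MatDiffOp N N) : Prop :=
  ∀ n, ∃ Λ : Matrix (Fin N) (Fin N) ℂ, MatDiffOp.act (P n) D = cmap Λ * P n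

/-- Membership in the module `𝒟(W, W̃)` (relative to the MOP sequences `P`, `Q`). -/
def InDWW {N1 N2 : ℕ} (P : ℕ → MatPoly N1 N1) (Q : ℕ → MatPoly N2 N2)
    (T : MatDiffOp N1 N2) : Prop :=
  ∀ n, ∃ A : Matrix (Fin N1) (Fin N2) ℂ, MatDiffOp.act (P n) T = cmap A * Q n

/-- A matrix polynomial has degree (exactly) `d`. -/
def hasDeg {n m : ℕ} (P : MatPoly n m) (d : ℕ) : Prop :=
  (∀ i j, (P i j).degree ≤ (d : WithBot ℕ)) ∧ ∃ i j, (P i j).degree = (d : WithBot ℕ)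

/-- A degree-preserving differential operator. -/
def DegreePreserving {n m : ℕ} (D : MatDiffOp n m) : Prop :=
  ∀ᶠ d in (atTop : Filter ℕ), ∀ f : Polynomial ℂ, f.degree = ((d : ℕ) : WithBot ℕ) → hasDeg (D.sact f) d

/-- `Q` is a Darboux transformation of `P`. -/
def IsDarboux {N : ℕ} (P Q : ℕ → MatPoly N N) : Prop :=
  ∃ (V Nop D : MatDiffOp N N) (A : ℕ → Matrix (Fin N) (Fin N) ℂ),
    DegreePreserving V ∧ DegreePreserving Nop ∧
    (∀ R : MatPoly N N, MatDiffOp.act R D = MatDiffOp.act (MatDiffOp.act R V) Nop) ∧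
    InDW P D ∧
    (∀ n, MatDiffOp.act (P n) V = cmap (A n) * Q n)
/-- The shifted sequence implementing the convention `ℓ₋₁ = 0`:
`lshift f n = f (n - 1)` for `n ≥ 1` and `lshift f 0 = 0`. -/
def lshift (f : ℕ → Polynomial ℂ) : ℕ → Polynomial ℂ
  | 0 => 0
  | n + 1 => f n

/-- `L β` is the monic orthogonal family for the Laguerre weight `e^{-x} x^β` on `(0, ∞)`,
for every `β > -1`. -/
def IsLaguerreFamily (L : ℝ → ℕ → Polynomial ℂ) : Prop :=
  ∀ β : ℝ, -1 < β → ∀ n : ℕ, (L β n).Monic ∧ (L β n).natDegree = n ∧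
    ∀ k < n, ∫ x in Set.Ioi (0 : ℝ),
      (L β n).eval (x : ℂ) * (x : ℂ) ^ k * ((Real.exp (-x) * x ^ β : ℝ) : ℂ) = 0

/-- The 2×2 weight `w₁` of Example 3. -/
def lagw1 (α : ℝ) (x : ℝ) : Matrix (Fin 2) (Fin 2) ℂ :=
  ((Real.exp (-x) * x ^ α : ℝ) : ℂ) •
    !![(x : ℂ) * (1 + (x : ℂ)), (x : ℂ); (x : ℂ), 1]

/-- The 2×2 weight `w₂` of Example 3. -/
def lagw2 (α : ℝ) (x : ℝ) : Matrix (Fin 2) (Fin 2) ℂ :=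
  ((Real.exp (-x) * x ^ α : ℝ) : ℂ) •
    !![1 + (x : ℂ) ^ 2, (x : ℂ); (x : ℂ), 1]

/-- The 4×4 Laguerre-type weight `W` of Example 3. -/
def lagW (α : ℝ) (x : ℝ) : Matrix (Fin 4) (Fin 4) ℂ :=
  ((Real.exp (-x) * x ^ α : ℝ) : ℂ) •
    !![(x : ℂ) ^ 2 + (x : ℂ), (x : ℂ), (x : ℂ) ^ 2, 0;
       (x : ℂ), 1, (x : ℂ), 0;
       (x : ℂ) ^ 2, (x : ℂ), 2 * (x : ℂ) ^ 2 + 1, (x : ℂ);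
       0, 0, (x : ℂ), 1]

/-- The orthogonal polynomials `P_{1,n}` for `w₁`. -/
def lagP1 (α : ℝ) (L : ℝ → ℕ → Polynomial ℂ) (n : ℕ) : MatPoly 2 2 :=
  !![L (α + 1) n, Polynomial.C (-((n : ℂ) + (α : ℂ) + 1)) * L α n;
     Polynomial.C (-(n : ℂ)) * lshift (L (α + 1)) n,
       Polynomial.C (n : ℂ) * X * lshift (L (α + 1)) n + L α n]

/-- The orthogonal polynomials `P_{2,n}` for `w₂`. -/
def lagP2 (α : ℝ) (L : ℝ → ℕ → Polynomial ℂ) (n : ℕ) : MatPoly 2 2 :=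
  !![L α n, L α (n + 1) - X * L α n;
     Polynomial.C (-((n : ℂ) * ((n : ℂ) + (α : ℂ)))) * lshift (L α) n,
       Polynomial.C ((n : ℂ) * ((n : ℂ) + (α : ℂ))) * X * lshift (L α) n + L α n]

/-- The orthogonal polynomials `Q_n` for the 4×4 weight `W`. -/
def lagQ (α : ℝ) (L : ℝ → ℕ → Polynomial ℂ) (n : ℕ) : MatPoly 4 4 :=
  !![L (α + 1) n, Polynomial.C (-((n : ℂ) + (α : ℂ) + 1)) * L α n, 0, 0;
     Polynomial.C (-(n : ℂ)) * lshift (L (α + 1)) n,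
       Polynomial.C (n : ℂ) * X * lshift (L (α + 1)) n + L α n
         + Polynomial.C ((n : ℂ) * ((n : ℂ) + (α : ℂ))) * X * lshift (L α) n,
       Polynomial.C (-((n : ℂ) * ((n : ℂ) + (α : ℂ)))) * lshift (L α) n,
       Polynomial.C ((n : ℂ) * ((n : ℂ) + (α : ℂ))) * X * lshift (L α) n;
     0, L α (n + 1) - X * L α n, L α n, L α (n + 1) - X * L α n;
     0, Polynomial.C ((n : ℂ) * ((n : ℂ) + (α : ℂ))) * X * lshift (L α) n,
       Polynomial.C (-((n : ℂ) * ((n : ℂ) + (α : ℂ)))) * lshift (L α) n,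
       Polynomial.C ((n : ℂ) * ((n : ℂ) + (α : ℂ))) * X * lshift (L α) n + L α n]
/-- Integrability of a complex polynomial against the Laguerre weight. -/
theorem integrableOn_eval_mul_laguerre {β : ℝ} (hβ : -1 < β) (p : ℂ[X]) :
    IntegrableOn (fun x : ℝ => p.eval (x : ℂ) * ((Real.exp (-x) * x ^ β : ℝ) : ℂ))
      (Set.Ioi 0) := by
  induction p using Polynomial.induction_on' with
  | add p q hp hq =>
    refine (hp.add hq).congr_fun (fun x _ => ?_) measurableSet_Ioi
    simp only [Pi.add_apply, eval_add]
    ring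
  | monomial k a =>
    have h := Real.GammaIntegral_convergent (s := β + k + 1) (by linarith [(k.cast_nonneg : (0 : ℝ) ≤ k)])
    have h' : IntegrableOn (fun x : ℝ =>
        a * ((Real.exp (-x) * x ^ (β + k + 1 - 1) : ℝ) : ℂ)) (Set.Ioi 0) :=
      h.ofReal.const_mul a
    refine h'.congr_fun (fun x hx => ?_) measurableSet_Ioi
    have hx' : (0 : ℝ) < x := hx
    simp only [add_sub_cancel_right, Real.rpow_add hx', Real.rpow_natCast, eval_monomial]
    push_cast
    ring

/-- Integration of complex polynomials against the Laguerre weight `e^{-x} x^β` on `(0, ∞)`. -/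
def laguerreIntegral (β : ℝ) (hβ : -1 < β) : ℂ[X] →ₗ[ℂ] ℂ where
  toFun p := ∫ x in Set.Ioi (0 : ℝ), p.eval (x : ℂ) * ((Real.exp (-x) * x ^ β : ℝ) : ℂ)
  map_add' p q := by
    rw [← integral_add (integrableOn_eval_mul_laguerre hβ p)
      (integrableOn_eval_mul_laguerre hβ q)]
    simp only [eval_add, add_mul]
  map_smul' a p := by
    rw [RingHom.id_apply, smul_eq_mul, ← integral_const_mul]
    simp only [eval_smul, smul_eq_mul, mul_assoc]

theorem laguerreIntegral_apply {β : ℝ} (hβ : -1 < β) (p : ℂ[X]) :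
    laguerreIntegral β hβ p =
      ∫ x in Set.Ioi (0 : ℝ), p.eval (x : ℂ) * ((Real.exp (-x) * x ^ β : ℝ) : ℂ) := rfl

theorem laguerreIntegral_C_mul {β : ℝ} (hβ : -1 < β) (a : ℂ) (p : ℂ[X]) :
    laguerreIntegral β hβ (C a * p) = a * laguerreIntegral β hβ p := by
  rw [← smul_eq_C_mul, map_smul, smul_eq_mul]

theorem laguerreIntegral_monomial {β : ℝ} (hβ : -1 < β) (k : ℕ) (a : ℂ) :
    laguerreIntegral β hβ (monomial k a) = a * (Real.Gamma (β + k + 1) : ℂ) := by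
  have hk : (0 : ℝ) < β + k + 1 := by linarith [(k.cast_nonneg : (0 : ℝ) ≤ k)]
  rw [Real.Gamma_eq_integral hk, laguerreIntegral_apply, ← integral_complex_ofReal,
    ← integral_const_mul]
  refine setIntegral_congr_fun measurableSet_Ioi fun x hx => ?_
  have hx' : (0 : ℝ) < x := hx
  simp only [add_sub_cancel_right, Real.rpow_add hx', Real.rpow_natCast, eval_monomial]
  push_cast
  ring

theorem laguerreIntegral_X_mul {β : ℝ} (hβ : -1 < β) (hβ' : -1 < β + 1) (p : ℂ[X]) :
    laguerreIntegral β hβ (X * p) = laguerreIntegral (β + 1) hβ' p := by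
  refine setIntegral_congr_fun measurableSet_Ioi fun x hx => ?_
  have hx' : (0 : ℝ) < x := hx
  simp only [Real.rpow_add hx', Real.rpow_one, eval_mul, eval_X]
  push_cast
  ring

/-- Integration by parts against the Laguerre weight. -/
theorem laguerreIntegral_eq_derivative {β : ℝ} (hβ : -1 < β) (hβ' : -1 < β + 1) (p : ℂ[X]) :
    laguerreIntegral (β + 1) hβ' p =
      laguerreIntegral (β + 1) hβ' (derivative p) + (β + 1) * laguerreIntegral β hβ p := by
  induction p using Polynomial.induction_on' with
  | add p q hp hq =>
    simp only [map_add, hp, hq]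
    ring
  | monomial k a =>
    have hk : (0 : ℝ) < β + k + 1 := by linarith [(k.cast_nonneg : (0 : ℝ) ≤ k)]
    have hG := Real.Gamma_add_one hk.ne'
    rw [← laguerreIntegral_X_mul hβ hβ', ← laguerreIntegral_X_mul hβ hβ', derivative_monomial,
      X_mul_monomial, laguerreIntegral_monomial, laguerreIntegral_monomial]
    rw [show β + ((k + 1 : ℕ) : ℝ) + 1 = β + k + 1 + 1 by push_cast; ring, hG]
    rcases k with _ | k
    · simp
      ring
    · rw [X_mul_monomial, Nat.add_sub_cancel, laguerreIntegral_monomial]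
      push_cast
      ring

theorem eval_map_conj_ofReal (p : ℂ[X]) (x : ℝ) :
    (p.map (starRingEnd ℂ)).eval (x : ℂ) = starRingEnd ℂ (p.eval (x : ℂ)) := by
  rw [eval_map, ← eval₂_at_apply, Complex.conj_ofReal]

theorem laguerreIntegral_map_conj {β : ℝ} (hβ : -1 < β) (p : ℂ[X]) :
    laguerreIntegral β hβ (p.map (starRingEnd ℂ)) = starRingEnd ℂ (laguerreIntegral β hβ p) := by
  rw [laguerreIntegral_apply, laguerreIntegral_apply, ← integral_conj]
  simp only [eval_map_conj_ofReal, map_mul, Complex.conj_ofReal]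

/-- `p` is monic of degree `n` and orthogonal to all polynomials of lower degree with respect to
the Laguerre weight with parameter `β`. -/
structure IsMonicLaguerre (β : ℝ) (hβ : -1 < β) (n : ℕ) (p : ℂ[X]) : Prop where
  monic : p.Monic
  natDegree_eq : p.natDegree = n
  integral_mul_X_pow : ∀ k < n, laguerreIntegral β hβ (p * X ^ k) = 0

theorem IsLaguerreFamily.isMonicLaguerre {L : ℝ → ℕ → ℂ[X]} (hL : IsLaguerreFamily L) {β : ℝ}
    (hβ : -1 < β) (n : ℕ) : IsMonicLaguerre β hβ n (L β n) := by
  obtain ⟨h1, h2, h3⟩ := hL β hβ n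
  refine ⟨h1, h2, fun k hk => ?_⟩
  rw [laguerreIntegral_apply, ← h3 k hk]
  simp only [eval_mul, eval_pow, eval_X]

namespace IsMonicLaguerre

variable {β : ℝ} {hβ : -1 < β} {n m : ℕ} {p q : ℂ[X]}

theorem coeff_eq_one (hp : IsMonicLaguerre β hβ n p) : p.coeff n = 1 := by
  have := hp.monic.coeff_natDegree
  rwa [hp.natDegree_eq] at this

theorem map_conj (hp : IsMonicLaguerre β hβ n p) :
    IsMonicLaguerre β hβ n (p.map (starRingEnd ℂ)) where
  monic := hp.monic.map _
  natDegree_eq := by rw [natDegree_map, hp.natDegree_eq]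
  integral_mul_X_pow k hk := by
    have h := laguerreIntegral_map_conj hβ (p * X ^ k)
    rwa [hp.integral_mul_X_pow k hk, map_zero, Polynomial.map_mul, Polynomial.map_pow,
      Polynomial.map_X] at h

theorem integral_mul (hp : IsMonicLaguerre β hβ n p) (hq : q.natDegree ≤ n) :
    laguerreIntegral β hβ (p * q) = q.coeff n * laguerreIntegral β hβ (p * X ^ n) := by
  rw [q.as_sum_range_C_mul_X_pow' (Nat.lt_succ_of_le hq), Finset.mul_sum, map_sum,
    Finset.sum_range_succ, Finset.sum_eq_zero, zero_add, mul_left_comm, laguerreIntegral_C_mul,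
    ← q.as_sum_range_C_mul_X_pow' (Nat.lt_succ_of_le hq)]
  intro k hk
  rw [mul_left_comm, laguerreIntegral_C_mul, hp.integral_mul_X_pow k (Finset.mem_range.mp hk),
    mul_zero]

theorem integral_mul_of_lt (hp : IsMonicLaguerre β hβ n p) (hq : q.natDegree < n) :
    laguerreIntegral β hβ (p * q) = 0 := by
  rw [hp.integral_mul hq.le, coeff_eq_zero_of_natDegree_lt hq, zero_mul]

theorem integral_mul_of_ne (hp : IsMonicLaguerre β hβ n p) (hq : IsMonicLaguerre β hβ m q)
    (h : n ≠ m) : laguerreIntegral β hβ (p * q) = 0 := by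
  rcases h.lt_or_gt with h | h
  · rw [mul_comm, hq.integral_mul_of_lt (hp.natDegree_eq.trans_lt h)]
  · rw [hp.integral_mul_of_lt (hq.natDegree_eq.trans_lt h)]

theorem integral_mul_self (hp : IsMonicLaguerre β hβ n p) (hq : IsMonicLaguerre β hβ n q) :
    laguerreIntegral β hβ (p * q) = laguerreIntegral β hβ (p * X ^ n) := by
  rw [hp.integral_mul hq.natDegree_eq.le, hq.coeff_eq_one, one_mul]

/-- The squared norm does not depend on the representative. -/
theorem integral_eq (hp : IsMonicLaguerre β hβ n p) (hq : IsMonicLaguerre β hβ n q) :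
    laguerreIntegral β hβ (p * X ^ n) = laguerreIntegral β hβ (q * X ^ n) := by
  rw [← hp.integral_mul_self hq, mul_comm, hq.integral_mul_self hp]

theorem norm_add_one {hβ' : -1 < β + 1} (hp : IsMonicLaguerre β hβ n p)
    (hq : IsMonicLaguerre (β + 1) hβ' n q) :
    laguerreIntegral (β + 1) hβ' (q * X ^ n) =
      (n + β + 1) * laguerreIntegral β hβ (p * X ^ n) := by
  have h0 := hq.integral_mul (q := p) hp.natDegree_eq.le
  rw [hp.coeff_eq_one, one_mul] at h0
  rw [← h0, laguerreIntegral_eq_derivative hβ hβ', derivative_mul, map_add]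
  have h1 : laguerreIntegral (β + 1) hβ' (derivative q * p) =
      n * laguerreIntegral β hβ (p * X ^ n) := by
    rw [← laguerreIntegral_X_mul hβ hβ', ← mul_assoc, mul_comm, hp.integral_mul]
    · rcases n with _ | n
      · simp
      · rw [coeff_X_mul, coeff_derivative, hq.coeff_eq_one]
        push_cast
        ring
    · rcases n with _ | n
      · rw [eq_C_of_natDegree_eq_zero hq.natDegree_eq]
        simp
      · refine natDegree_mul_le.trans ?_
        have := natDegree_derivative_le q
        rw [hq.natDegree_eq] at this
        rw [natDegree_X]
        omega
  have h2 : laguerreIntegral (β + 1) hβ' (q * derivative p) = 0 := by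
    rcases n with _ | n
    · rw [eq_C_of_natDegree_eq_zero hp.natDegree_eq]
      simp
    · have := natDegree_derivative_le p
      rw [hp.natDegree_eq] at this
      exact hq.integral_mul_of_lt (by omega)
  rw [h1, h2, mul_comm q p, hp.integral_mul hq.natDegree_eq.le, hq.coeff_eq_one]
  ring

theorem norm_succ {hβ' : -1 < β + 1} (hp : IsMonicLaguerre β hβ (n + 1) p)
    (hq : IsMonicLaguerre (β + 1) hβ' n q) :
    laguerreIntegral β hβ (p * X ^ (n + 1)) =
      (n + 1) * laguerreIntegral (β + 1) hβ' (q * X ^ n) := by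
  have hXq : (X * q).natDegree ≤ n + 1 := by
    rw [natDegree_X_mul hq.monic.ne_zero, hq.natDegree_eq]
  have hdq : (X * derivative q).natDegree < n + 1 := by
    rcases n with _ | n
    · rw [eq_C_of_natDegree_eq_zero hq.natDegree_eq]
      simp
    · have h1 := natDegree_derivative_le q
      have h2 := natDegree_mul_le (p := X) (q := derivative q)
      rw [hq.natDegree_eq] at h1
      rw [natDegree_X] at h2
      omega
  have hdp : (derivative p).natDegree ≤ n := by
    have h1 := natDegree_derivative_le p
    rwa [hp.natDegree_eq] at h1
  have h := laguerreIntegral_eq_derivative hβ hβ' (q * p)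
  rw [derivative_mul, map_add, ← laguerreIntegral_X_mul hβ hβ', ← mul_assoc, mul_comm _ p,
    hp.integral_mul hXq, coeff_X_mul, hq.coeff_eq_one, one_mul,
    ← laguerreIntegral_X_mul hβ hβ' (derivative q * p), ← mul_assoc, mul_comm _ p,
    hp.integral_mul_of_lt hdq, hq.integral_mul hdp, coeff_derivative, hp.coeff_eq_one, one_mul,
    mul_comm q p, hp.integral_mul_of_lt (hq.natDegree_eq.trans_lt n.lt_succ_self), zero_add,
    mul_zero, add_zero] at h
  exact h

/-- Raising the parameter by one and multiplying by the variable. -/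
theorem X_mul_sub {hβ' : -1 < β + 1} (hp : IsMonicLaguerre β hβ n p)
    (hq : IsMonicLaguerre (β + 1) hβ' n q) :
    IsMonicLaguerre β hβ (n + 1) (X * q - C ((n : ℂ) + β + 1) * p) := by
  have hXq : (X * q).Monic := monic_X.mul hq.monic
  have hdX : (X * q).natDegree = n + 1 := by
    rw [natDegree_X_mul hq.monic.ne_zero, hq.natDegree_eq]
  have hlt : (C ((n : ℂ) + β + 1) * p).natDegree < (X * q).natDegree :=
    (natDegree_C_mul_le _ _).trans_lt (by rw [hdX, hp.natDegree_eq]; exact n.lt_succ_self)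
  refine ⟨hXq.sub_of_left (degree_lt_degree hlt),
    (natDegree_sub_eq_left_of_natDegree_lt hlt).trans hdX, fun k hk => ?_⟩
  rw [sub_mul, map_sub, mul_assoc, mul_assoc, laguerreIntegral_X_mul hβ hβ',
    laguerreIntegral_C_mul]
  rcases (Nat.lt_succ_iff.mp hk).lt_or_eq with h | rfl
  · rw [hp.integral_mul_X_pow k h, hq.integral_mul_X_pow k h, mul_zero, sub_zero]
  · rw [hp.norm_add_one hq, sub_self]

end IsMonicLaguerre

/-- Orthogonality of a sequence of `2 × 2` matrix polynomials for the weight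
`T diag(e^{-x} x^β, e^{-x} x^γ) T^*` with `T = [[1, x], [0, 1]]`. -/
theorem isMOP_laguerre {β γ : ℝ} {hβ : -1 < β} {hγ : -1 < γ} {A B D : ℕ → ℂ[X]}
    {κ : ℕ → ℝ} {W : ℝ → Matrix (Fin 2) (Fin 2) ℂ} {P : ℕ → MatPoly 2 2}
    (hA : ∀ n, IsMonicLaguerre β hβ n (A n)) (hB : ∀ n, IsMonicLaguerre γ hγ (n + 1) (B n))
    (hD : ∀ n, IsMonicLaguerre γ hγ n (D n)) (hκ : ∀ n, 0 ≤ κ n)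
    (hnorm : ∀ n, κ (n + 1) * laguerreIntegral β hβ (A n * X ^ n) =
      laguerreIntegral γ hγ (D (n + 1) * X ^ (n + 1)))
    (hW : ∀ x > 0, W x = !![((Real.exp (-x) * x ^ β : ℝ) : ℂ) +
        x ^ 2 * ((Real.exp (-x) * x ^ γ : ℝ) : ℂ), x * ((Real.exp (-x) * x ^ γ : ℝ) : ℂ);
      x * ((Real.exp (-x) * x ^ γ : ℝ) : ℂ), ((Real.exp (-x) * x ^ γ : ℝ) : ℂ)])
    (hP : ∀ n, P n = !![A n, B n - X * A n; -(C (κ n : ℂ) * lshift A n),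
      D n + C (κ n : ℂ) * X * lshift A n]) :
    IsMOP (Set.Ioi 0) W P := by
  set a : ℕ → Fin 2 → ℂ[X] := fun n => ![A n, -(C (κ n : ℂ) * lshift A n)] with ha
  set b : ℕ → Fin 2 → ℂ[X] := fun n => ![B n, D n] with hb
  have hP0 : ∀ n i, P n i 0 = a n i := fun n i => by
    fin_cases i <;> simp [hP, ha]
  have hP1 : ∀ n i, P n i 1 = b n i - X * a n i := fun n i => by
    fin_cases i <;> simp [hP, ha, hb]
    ring
  have hE : ∀ n m i j, Set.EqOn
      (fun x => (evalM (P n) x * W x * (evalM (P m) x)ᴴ) i j)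
      (fun x => (a n i * (a m j).map (starRingEnd ℂ)).eval (x : ℂ) *
          ((Real.exp (-x) * x ^ β : ℝ) : ℂ) +
        (b n i * (b m j).map (starRingEnd ℂ)).eval (x : ℂ) *
          ((Real.exp (-x) * x ^ γ : ℝ) : ℂ)) (Set.Ioi 0) := by
    intro n m i j x hx
    simp only [hW x hx, Matrix.mul_apply, Fin.sum_univ_two, evalM, Matrix.of_apply,
      Matrix.conjTranspose_apply, hP0, hP1, eval_mul, eval_sub, eval_X, eval_map_conj_ofReal,
      Matrix.cons_val_zero, Matrix.cons_val_one, Matrix.cons_val', Matrix.cons_val_fin_one,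
      ← starRingEnd_apply, map_sub, map_mul, Complex.conj_ofReal]
    ring
  have hlD : ∀ n, (lshift A n).natDegree ≤ n - 1 := fun n => by
    rcases n with _ | n
    · simp [lshift]
    · exact (hA n).natDegree_eq.le
  have hXl : ∀ n, (C (κ n : ℂ) * X * lshift A n).natDegree ≤ n := fun n => by
    rcases n with _ | n
    · simp [lshift]
    · rw [mul_assoc]
      refine (natDegree_C_mul_le _ _).trans ?_
      rw [lshift, natDegree_X_mul (hA n).monic.ne_zero, (hA n).natDegree_eq]
  have hBX : ∀ n, (B n - X * A n).natDegree ≤ n := fun n => by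
    rw [natDegree_le_iff_coeff_eq_zero]
    intro k hk
    rcases (Nat.succ_le_of_lt hk).eq_or_lt with rfl | hk'
    · rw [coeff_sub, (hB n).coeff_eq_one, Nat.succ_eq_add_one, coeff_X_mul, (hA n).coeff_eq_one,
        sub_self]
    · rw [coeff_sub, coeff_eq_zero_of_natDegree_lt ((hB n).natDegree_eq.trans_lt hk'),
        coeff_eq_zero_of_natDegree_lt, sub_zero]
      rwa [natDegree_X_mul (hA n).monic.ne_zero, (hA n).natDegree_eq]
  have hI : ∀ n m i j, innerW (Set.Ioi 0) W (P n) (P m) i j =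
      laguerreIntegral β hβ (a n i * (a m j).map (starRingEnd ℂ)) +
        laguerreIntegral γ hγ (b n i * (b m j).map (starRingEnd ℂ)) := by
    intro n m i j
    rw [innerW, Matrix.of_apply, setIntegral_congr_fun measurableSet_Ioi (hE n m i j),
      integral_add (integrableOn_eval_mul_laguerre hβ _) (integrableOn_eval_mul_laguerre hγ _)]
    rfl
  refine ⟨fun n i j => ?_, fun n => ?_, fun n m i j => ?_, fun n m hnm => ?_⟩
  · fin_cases i <;> fin_cases j <;> simp only [hP]
    · exact (hA n).natDegree_eq.le
    · exact hBX n
    · refine (natDegree_neg _).trans_le ((natDegree_C_mul_le _ _).trans ((hlD n).trans ?_))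
      exact n.sub_le 1
    · exact (natDegree_add_le _ _).trans (max_le (hD n).natDegree_eq.le (hXl n))
  · rw [Matrix.isUnit_iff_isUnit_det, Matrix.det_fin_two, isUnit_iff_ne_zero]
    have h10 : (lshift A n).coeff n = 0 := by
      rcases n with _ | n
      · simp [lshift]
      · exact coeff_eq_zero_of_natDegree_lt ((hA n).natDegree_eq.trans_lt n.lt_succ_self)
    have h11 : ∃ t : ℝ, 0 ≤ t ∧ (C (κ n : ℂ) * X * lshift A n).coeff n = (t : ℂ) := by
      rcases n with _ | n
      · exact ⟨0, le_rfl, by simp [lshift]⟩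
      · refine ⟨κ (n + 1), hκ _, ?_⟩
        rw [mul_assoc, coeff_C_mul, coeff_X_mul, lshift, (hA n).coeff_eq_one, mul_one]
    obtain ⟨t, ht, h11⟩ := h11
    simp only [Matrix.of_apply, hP, Matrix.cons_val_zero, Matrix.cons_val_one, Matrix.cons_val',
      Matrix.cons_val_fin_one, coeff_add, coeff_neg, coeff_C_mul, h10, h11,
      (hA n).coeff_eq_one, (hD n).coeff_eq_one, mul_zero, neg_zero, sub_zero, one_mul]
    exact_mod_cast (by positivity : (1 + t) ≠ 0)
  · exact ((integrableOn_eval_mul_laguerre hβ _).add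
      (integrableOn_eval_mul_laguerre hγ _)).congr_fun (hE n m i j).symm measurableSet_Ioi
  · have hcross : ∀ n m, n ≠ m →
        laguerreIntegral β hβ (A n * (C (κ m : ℂ) * (lshift A m).map (starRingEnd ℂ))) =
          laguerreIntegral γ hγ (B n * (D m).map (starRingEnd ℂ)) ∧
        laguerreIntegral β hβ (C (κ m : ℂ) * lshift A m * (A n).map (starRingEnd ℂ)) =
          laguerreIntegral γ hγ (D m * (B n).map (starRingEnd ℂ)) := by
      intro n m hnm
      rw [mul_left_comm, mul_assoc, laguerreIntegral_C_mul, laguerreIntegral_C_mul]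
      rcases m with _ | m
      · simp only [lshift, Polynomial.map_zero, mul_zero, zero_mul, map_zero]
        rw [(hB n).integral_mul_of_ne (hD 0).map_conj n.succ_ne_zero,
          (hD 0).integral_mul_of_ne (hB n).map_conj n.succ_ne_zero.symm]
        simp
      · simp only [lshift]
        rcases eq_or_ne n m with rfl | h
        · rw [(hA n).integral_mul_self (hA n).map_conj, hnorm,
            (hB n).integral_mul_self (hD (n + 1)).map_conj, (hB n).integral_eq (hD (n + 1)),
            (hD (n + 1)).integral_mul_self (hB n).map_conj]
          exact ⟨rfl, rfl⟩
        · have h' : n + 1 ≠ m + 1 := by omega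
          rw [(hA n).integral_mul_of_ne (hA m).map_conj h,
            (hA m).integral_mul_of_ne (hA n).map_conj h.symm,
            (hB n).integral_mul_of_ne (hD (m + 1)).map_conj h',
            (hD (m + 1)).integral_mul_of_ne (hB n).map_conj h'.symm]
          simp
    ext i j
    rw [hI, Matrix.zero_apply]
    fin_cases i <;> fin_cases j <;> simp [ha, hb]
    · rw [(hA n).integral_mul_of_ne (hA m).map_conj hnm,
        (hB n).integral_mul_of_ne (hB m).map_conj (by omega), add_zero]
    · rw [(hcross n m hnm).1, neg_add_cancel]
    · rw [(hcross m n hnm.symm).2, neg_add_cancel]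
    · rw [(hD n).integral_mul_of_ne (hD m).map_conj hnm, add_zero]
      rw [show C (κ n : ℂ) * lshift A n * (C (κ m : ℂ) * (lshift A m).map (starRingEnd ℂ)) =
        C (κ n : ℂ) * (C (κ m : ℂ) * (lshift A n * (lshift A m).map (starRingEnd ℂ))) by ring,
        laguerreIntegral_C_mul, laguerreIntegral_C_mul]
      rcases n with _ | n
      · simp [lshift]
      rcases m with _ | m
      · simp [lshift]
      rw [lshift, lshift, (hA n).integral_mul_of_ne (hA m).map_conj (by omega), mul_zero, mul_zero]

/-- `P_{1,n}` and `P_{2,n}` are MOP sequences for `w₁` and `w₂`. -/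
theorem statement_15 (α : ℝ) (hα : -1 < α)
    (L : ℝ → ℕ → Polynomial ℂ) (hL : IsLaguerreFamily L) :
    IsMOP (Set.Ioi 0) (lagw1 α) (lagP1 α L) ∧
    IsMOP (Set.Ioi 0) (lagw2 α) (lagP2 α L) := by
  have hα' : -1 < α + 1 := by linarith
  have h0 := hL.isMonicLaguerre hα
  have h1 := hL.isMonicLaguerre hα'
  refine ⟨isMOP_laguerre h1 (fun n => (h0 n).X_mul_sub (h1 n)) h0 (κ := fun n => n)
      (fun n => n.cast_nonneg) (fun n => ?_) (fun x hx => ?_) (fun n => ?_),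
    isMOP_laguerre h0 (fun n => h0 (n + 1)) h0 (κ := fun n => n * (n + α))
      (fun n => ?_) (fun n => ?_) (fun x hx => ?_) (fun n => ?_)⟩
  · rw [(h0 (n + 1)).norm_succ (h1 n)]
    push_cast
    ring
  · rw [lagw1, Real.rpow_add hx, Real.rpow_one]
    ext i j
    fin_cases i <;> fin_cases j <;> simp <;> ring
  · ext1 i j
    fin_cases i <;> fin_cases j <;> simp [lagP1] <;> ring
  · rcases n with _ | n
    · simp
    · have hn : (0 : ℝ) ≤ n := n.cast_nonneg
      push_cast
      exact mul_nonneg (by linarith) (by linarith)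
  · rw [(h0 (n + 1)).norm_succ (h1 n), (h0 n).norm_add_one (h1 n)]
    push_cast
    ring
  · rw [lagw2]
    ext i j
    fin_cases i <;> fin_cases j <;> simp <;> ring
  · ext1 i j
    fin_cases i <;> fin_cases j <;> simp [lagP2]
    ring
end
end

section
/- Let α > −1 and, for each n ≥ 0, let ℓ_n^{(α)} be the monic degree-n polynomial with ∫_0^∞ ℓ_n^{(α)}(x) x^k e^{−x} x^α dx = 0 for 0 ≤ k < n (with the convention ℓ_{−1}^{(α)} = 0). Let W(x) = e^{−x} x^α·[[x² + x, x, x², 0],[x, 1, x, 0],[x², x, 2x² + 1, x],[0, 0, x, 1]] on (0,∞). Then the sequence of 4×4 matrix polynomials Q_n(x) with rows (ℓ_n^{(α+1)}, −(n+α+1)ℓ_n^{(α)}, 0, 0), (−n ℓ_{n−1}^{(α+1)}, n x ℓ_{n−1}^{(α+1)} + ℓ_n^{(α)} + n(n+α) x ℓ_{n−1}^{(α)}, −n(n+α) ℓ_{n−1}^{(α)}, n(n+α) x ℓ_{n−1}^{(α)}), (0, ℓ_{n+1}^{(α)} − x ℓ_n^{(α)}, ℓ_n^{(α)}, ℓ_{n+1}^{(α)}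 − x ℓ_n^{(α)}), and (0, n(n+α) x ℓ_{n−1}^{(α)}, −n(n+α) ℓ_{n−1}^{(α)}, n(n+α) x ℓ_{n−1}^{(α)} + ℓ_n^{(α)}) is a sequence of matrix orthogonal polynomials with respect to W. -/
open MeasureTheory Filter Polynomial Matrix
open scoped ComplexOrder

noncomputable section

/-- The moment functional of the weight `e^{-x} x^β`, given by `x ^ k ↦ Γ(β + 1 + k)`. -/
def laguerreFunctional (β : ℝ) : ℂ[X] →ₗ[ℂ] ℂ :=
  Polynomial.lsum fun k => ((Real.Gamma (β + 1 + k) : ℝ) : ℂ) • LinearMap.id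

lemma laguerreFunctional_monomial (β : ℝ) (k : ℕ) (a : ℂ) :
    laguerreFunctional β (monomial k a) = (Real.Gamma (β + 1 + k) : ℝ) * a := by
  simp [laguerreFunctional, Polynomial.lsum, sum_monomial_index]

lemma laguerreFunctional_X_mul (β : ℝ) (p : ℂ[X]) :
    laguerreFunctional β (X * p) = laguerreFunctional (β + 1) p := by
  induction p using Polynomial.induction_on' with
  | add p q hp hq => simp only [mul_add, map_add, hp, hq]
  | monomial k a =>
    rw [X_mul_monomial, laguerreFunctional_monomial, laguerreFunctional_monomial]
    congr 3
    push_cast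
    ring

lemma laguerreFunctional_C_mul (β : ℝ) (a : ℂ) (p : ℂ[X]) :
    laguerreFunctional β (C a * p) = a * laguerreFunctional β p := by
  rw [← smul_eq_C_mul, map_smul, smul_eq_mul]

/-- Integration by parts against the weight `e^{-x} x^β`. -/
lemma laguerreFunctional_X_mul_derivative {β : ℝ} (hβ : -1 < β) (p : ℂ[X]) :
    laguerreFunctional β (X * derivative p) =
      laguerreFunctional β (X * p) - (β + 1) * laguerreFunctional β p := by
  induction p using Polynomial.induction_on' with
  | add p q hp hq =>
    simp only [map_add, mul_add, hp, hq]
    ring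
  | monomial k a =>
    have hk : X * derivative (monomial k a) = monomial k (a * k) := by
      cases k with
      | zero => simp
      | succ k => simp [X_mul_monomial]
    have hG : Real.Gamma (β + 1 + (k + 1 : ℕ)) = (β + 1 + k) * Real.Gamma (β + 1 + k) := by
      have hk0 : (0 : ℝ) ≤ k := k.cast_nonneg
      rw [← Real.Gamma_add_one (by linarith)]
      push_cast
      ring_nf
    rw [hk, X_mul_monomial, laguerreFunctional_monomial, laguerreFunctional_monomial,
      laguerreFunctional_monomial, hG]
    push_cast
    ring

lemma laguerreFunctional_map_conj (β : ℝ) (p : ℂ[X]) :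
    laguerreFunctional β (p.map (starRingEnd ℂ)) =
      starRingEnd ℂ (laguerreFunctional β p) := by
  induction p using Polynomial.induction_on' with
  | add p q hp hq => simp only [Polynomial.map_add, map_add, hp, hq]
  | monomial k a =>
    rw [map_monomial, laguerreFunctional_monomial, laguerreFunctional_monomial, map_mul,
      Complex.conj_ofReal]

lemma integrableOn_and_integral_eval_mul_laguerre {β : ℝ} (hβ : -1 < β) (p : ℂ[X]) :
    IntegrableOn (fun x : ℝ => p.eval (x : ℂ) * ((Real.exp (-x) * x ^ β : ℝ) : ℂ)) (Set.Ioi 0) ∧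
      ∫ x in Set.Ioi (0 : ℝ), p.eval (x : ℂ) * ((Real.exp (-x) * x ^ β : ℝ) : ℂ) =
        laguerreFunctional β p := by
  induction p using Polynomial.induction_on' with
  | add p q hp hq =>
    simp only [eval_add, add_mul, map_add]
    exact ⟨hp.1.add hq.1, by rw [integral_add hp.1 hq.1, hp.2, hq.2]⟩
  | monomial k a =>
    have hpos : 0 < β + 1 + k := by
      have : (0 : ℝ) ≤ k := k.cast_nonneg
      linarith
    have heq : Set.EqOn
        (fun x : ℝ => a * ((Real.exp (-x) * x ^ (β + 1 + k - 1) : ℝ) : ℂ))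
        (fun x : ℝ => (monomial k a).eval (x : ℂ) * ((Real.exp (-x) * x ^ β : ℝ) : ℂ))
        (Set.Ioi 0) := by
      intro x hx
      have hx : (0 : ℝ) < x := hx
      have : x ^ (β + 1 + k - 1) = x ^ β * x ^ k := by
        rw [← Real.rpow_natCast, ← Real.rpow_add hx]
        ring_nf
      simp only [this, eval_monomial]
      push_cast
      ring
    constructor
    · have h : IntegrableOn
          (fun x : ℝ => a * ((Real.exp (-x) * x ^ (β + 1 + k - 1) : ℝ) : ℂ)) (Set.Ioi 0) :=
        (Real.GammaIntegral_convergent hpos).ofReal.const_mul a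
      exact h.congr_fun heq measurableSet_Ioi
    · rw [← setIntegral_congr_fun measurableSet_Ioi heq, integral_const_mul,
        integral_complex_ofReal, ← Real.Gamma_eq_integral hpos, laguerreFunctional_monomial,
        mul_comm]

/-- The functional applied to the product of a polynomial orthogonal to lower degrees
with one of degree at most `n` only sees the leading term. -/
lemma laguerreFunctional_mul_eq_coeff {β : ℝ} {n : ℕ} {q f : ℂ[X]}
    (hq : ∀ k < n, laguerreFunctional β (q * X ^ k) = 0) (hf : f.natDegree ≤ n) :
    laguerreFunctional β (q * f) = f.coeff n * laguerreFunctional β (q * X ^ n) := by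
  conv_lhs => rw [f.as_sum_range_C_mul_X_pow' (Nat.lt_succ_of_le hf)]
  rw [Finset.mul_sum, map_sum, Finset.sum_range_succ, Finset.sum_eq_zero, zero_add,
    mul_left_comm, laguerreFunctional_C_mul]
  intro k hk
  rw [mul_left_comm, laguerreFunctional_C_mul, hq k (Finset.mem_range.1 hk), mul_zero]

lemma laguerreFunctional_mul_eq_zero {β : ℝ} {n : ℕ} {q f : ℂ[X]}
    (hq : ∀ k < n, laguerreFunctional β (q * X ^ k) = 0) (hf : f.degree < n) :
    laguerreFunctional β (q * f) = 0 := by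
  rw [laguerreFunctional_mul_eq_coeff hq (natDegree_le_of_degree_le hf.le),
    coeff_eq_zero_of_degree_lt hf, zero_mul]

namespace IsLaguerreFamily

variable {L : ℝ → ℕ → ℂ[X]} {β : ℝ}

lemma orthogonal (hL : IsLaguerreFamily L) (hβ : -1 < β) (n k : ℕ) (hk : k < n) :
    laguerreFunctional β (L β n * X ^ k) = 0 := by
  rw [← (integrableOn_and_integral_eval_mul_laguerre hβ _).2]
  simpa using (hL β hβ n).2.2 k hk

lemma coeff_self (hL : IsLaguerreFamily L) (hβ : -1 < β) (n : ℕ) : (L β n).coeff n = 1 := by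
  obtain ⟨h1, h2, -⟩ := hL β hβ n
  rw [Monic, leadingCoeff, h2] at h1
  exact h1

lemma degree_eq (hL : IsLaguerreFamily L) (hβ : -1 < β) (n : ℕ) : (L β n).degree = n := by
  rw [degree_eq_natDegree (hL β hβ n).1.ne_zero, (hL β hβ n).2.1]

lemma natDegree_eq (hL : IsLaguerreFamily L) (hβ : -1 < β) (n : ℕ) : (L β n).natDegree = n :=
  (hL β hβ n).2.1

lemma norm_succ (hL : IsLaguerreFamily L) (hβ : -1 < β) (n : ℕ) :
    laguerreFunctional β (L β (n + 1) * X ^ (n + 1)) =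
      (n + 1) * laguerreFunctional (β + 1) (L (β + 1) n * X ^ n) := by
  have hβ' : -1 < β + 1 := by linarith
  set q := L β (n + 1) with hq
  set r := L (β + 1) n with hr
  have horq := hL.orthogonal hβ (n + 1)
  have horr := hL.orthogonal hβ' n
  have hdq : (derivative q).natDegree ≤ n := by
    have := natDegree_derivative_le q
    rwa [hL.natDegree_eq hβ] at this
  have h1 := laguerreFunctional_mul_eq_coeff horr hdq
  rw [coeff_derivative, hL.coeff_self hβ, ← hr, one_mul] at h1
  have h2 := laguerreFunctional_X_mul_derivative hβ (r * q)
  have h3 : laguerreFunctional β (q * r) = 0 :=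
    laguerreFunctional_mul_eq_zero horq (by
      rw [hL.degree_eq hβ']; exact_mod_cast n.lt_succ_self)
  have h4 : laguerreFunctional β (q * (X * derivative r)) = 0 := by
    refine laguerreFunctional_mul_eq_zero horq ?_
    rw [degree_lt_iff_coeff_zero]
    intro m hm
    obtain ⟨k, rfl⟩ := Nat.exists_eq_add_of_le' (Nat.one_le_of_lt hm)
    rw [coeff_X_mul, coeff_derivative, coeff_eq_zero_of_natDegree_lt, zero_mul]
    rw [hL.natDegree_eq hβ']
    omega
  have h5 := laguerreFunctional_mul_eq_coeff horq (f := X * r) (by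
    rw [natDegree_X_mul (hL _ hβ' n).1.ne_zero, hL.natDegree_eq hβ'])
  rw [coeff_X_mul, hL.coeff_self hβ', one_mul, ← hq] at h5
  rw [← h1, ← h5, ← laguerreFunctional_X_mul,
    show X * (r * derivative q) = X * derivative (r * q) - q * (X * derivative r) by
      rw [derivative_mul]; ring, map_sub, h4, h2, mul_comm r q, h3]
  ring_nf

lemma norm_add_one (hL : IsLaguerreFamily L) (hβ : -1 < β) (n : ℕ) :
    laguerreFunctional (β + 1) (L (β + 1) n * X ^ n) =
      (n + β + 1) * laguerreFunctional β (L β n * X ^ n) := by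
  have hβ' : -1 < β + 1 := by linarith
  induction n generalizing β with
  | zero =>
    have h0 : ∀ γ : ℝ, -1 < γ → L γ 0 = 1 := fun γ hγ =>
      (hL γ hγ 0).1.natDegree_eq_zero.1 (hL.natDegree_eq hγ 0)
    rw [h0 _ hβ, h0 _ hβ', ← laguerreFunctional_X_mul]
    have := laguerreFunctional_X_mul_derivative hβ 1
    simp only [derivative_one, mul_zero, map_zero, mul_one, pow_zero, Nat.cast_zero,
      zero_add] at this ⊢
    linear_combination -this
  | succ n ih =>
    rw [hL.norm_succ hβ', hL.norm_succ hβ, ih hβ' (by linarith)]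
    push_cast
    ring

end IsLaguerreFamily

/-- The polynomial part of the weight `lagW`. -/
def lagWPoly : MatPoly 4 4 :=
  !![X ^ 2 + X, X, X ^ 2, 0;
     X, 1, X, 0;
     X ^ 2, X, 2 * X ^ 2 + 1, X;
     0, 0, X, 1]

lemma lagW_eq (α x : ℝ) :
    lagW α x = ((Real.exp (-x) * x ^ α : ℝ) : ℂ) • evalM lagWPoly x := by
  unfold lagW
  congr 1
  ext i j
  fin_cases i <;> fin_cases j <;> simp [evalM, lagWPoly]

lemma evalM_mul {a b c : ℕ} (P : MatPoly a b) (Q : MatPoly b c) (x : ℝ) :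
    evalM (P * Q) x = evalM P x * evalM Q x :=
  Matrix.map_mul (f := evalRingHom (x : ℂ))

/-- The conjugate transpose of a matrix polynomial in a real variable. -/
def conjTransposeM {a b : ℕ} (P : MatPoly a b) : MatPoly b a :=
  (P.map (Polynomial.map (starRingEnd ℂ)))ᵀ

lemma evalM_conjTransposeM {a b : ℕ} (P : MatPoly a b) (x : ℝ) :
    evalM (conjTransposeM P) x = (evalM P x)ᴴ := by
  ext i j
  simp only [evalM, conjTransposeM, of_apply, transpose_apply, map_apply, conjTranspose_apply]
  conv_lhs => rw [← Complex.conj_ofReal x, eval_map_apply]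
  rfl

lemma lagWPoly_conjTransposeM : conjTransposeM lagWPoly = lagWPoly := by
  ext1 i j
  fin_cases i <;> fin_cases j <;> simp [conjTransposeM, lagWPoly]

lemma conjTransposeM_mul {a b c : ℕ} (P : MatPoly a b) (Q : MatPoly b c) :
    conjTransposeM (P * Q) = conjTransposeM Q * conjTransposeM P := by
  unfold conjTransposeM
  rw [← transpose_mul]
  exact congrArg _ (Matrix.map_mul (f := mapRingHom (starRingEnd ℂ)))

lemma conjTransposeM_conjTransposeM {a b : ℕ} (P : MatPoly a b) :
    conjTransposeM (conjTransposeM P) = P := by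
  ext i j : 2
  simp [conjTransposeM, Polynomial.map_map]

lemma lagW_integrand (α : ℝ) {a b : ℕ} (P : MatPoly a 4) (Q : MatPoly b 4) (i : Fin a)
    (j : Fin b) (x : ℝ) :
    (evalM P x * lagW α x * (evalM Q x)ᴴ) i j =
      ((P * lagWPoly * conjTransposeM Q) i j).eval (x : ℂ) *
        ((Real.exp (-x) * x ^ α : ℝ) : ℂ) := by
  rw [lagW_eq, Matrix.mul_smul, Matrix.smul_mul, ← evalM_conjTransposeM, ← evalM_mul,
    ← evalM_mul, Matrix.smul_apply, smul_eq_mul, mul_comm]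
  rfl

lemma innerW_lagW {α : ℝ} (hα : -1 < α) {a b : ℕ} (P : MatPoly a 4) (Q : MatPoly b 4)
    (i : Fin a) (j : Fin b) :
    innerW (Set.Ioi 0) (lagW α) P Q i j =
      laguerreFunctional α ((P * lagWPoly * conjTransposeM Q) i j) := by
  simp only [innerW, of_apply, lagW_integrand]
  exact (integrableOn_and_integral_eval_mul_laguerre hα _).2

lemma laguerreFunctional_conj_symm (α : ℝ) {a b : ℕ} (P : MatPoly a 4) (Q : MatPoly b 4)
    (i : Fin a) (j : Fin b) :
    laguerreFunctional α ((P * lagWPoly * conjTransposeM Q) i j) =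
      starRingEnd ℂ (laguerreFunctional α ((Q * lagWPoly * conjTransposeM P) j i)) := by
  rw [← laguerreFunctional_map_conj]
  have : P * lagWPoly * conjTransposeM Q = conjTransposeM (Q * lagWPoly * conjTransposeM P) := by
    rw [conjTransposeM_mul, conjTransposeM_mul, conjTransposeM_conjTransposeM,
      lagWPoly_conjTransposeM, Matrix.mul_assoc]
  rw [this]
  rfl

namespace IsLaguerreFamily

variable {L : ℝ → ℕ → ℂ[X]} {α : ℝ}

lemma natDegree_sub_X_mul_le (hL : IsLaguerreFamily L) (hα : -1 < α) (n : ℕ) :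
    (L α (n + 1) - X * L α n).natDegree ≤ n := by
  rw [natDegree_le_iff_coeff_eq_zero]
  intro m hm
  obtain ⟨k, rfl⟩ := Nat.exists_eq_add_of_le' (Nat.one_le_of_lt hm)
  rw [coeff_sub, coeff_X_mul]
  rcases eq_or_lt_of_le (Nat.le_of_lt_succ hm) with rfl | hk
  · rw [hL.coeff_self hα, hL.coeff_self hα, sub_self]
  · rw [coeff_eq_zero_of_natDegree_lt, coeff_eq_zero_of_natDegree_lt, sub_self] <;>
    rw [hL.natDegree_eq hα] <;> omega

lemma natDegree_lshift_le (hL : IsLaguerreFamily L) (hα : -1 < α) (n : ℕ) :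
    (lshift (L α) n).natDegree ≤ n - 1 := by
  cases n with
  | zero => simp [lshift]
  | succ n => exact (hL.natDegree_eq hα n).le

lemma natDegree_X_mul_lshift_le (hL : IsLaguerreFamily L) (hα : -1 < α) (n : ℕ) :
    (X * lshift (L α) n).natDegree ≤ n := by
  cases n with
  | zero => simp [lshift]
  | succ n =>
    refine natDegree_mul_le.trans ?_
    rw [natDegree_X, lshift, hL.natDegree_eq hα, add_comm]

lemma natDegree_lagQ_le (hL : IsLaguerreFamily L) (hα : -1 < α) (n : ℕ) (i j : Fin 4) :
    (lagQ α L n i j).natDegree ≤ n := by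
  have hα' : -1 < α + 1 := by linarith
  have hC : ∀ (c : ℂ) {p : ℂ[X]}, p.natDegree ≤ n → (C c * p).natDegree ≤ n :=
    fun c p hp => (natDegree_C_mul_le c p).trans hp
  have hadd : ∀ {p q : ℂ[X]}, p.natDegree ≤ n → q.natDegree ≤ n → (p + q).natDegree ≤ n :=
    fun hp hq => natDegree_add_le_of_degree_le hp hq
  have h0 : (0 : ℂ[X]).natDegree ≤ n := by simp
  have h1 := (hL.natDegree_eq hα n).le
  have h1' := (hL.natDegree_eq hα' n).le
  have h2 := (hL.natDegree_lshift_le hα n).trans (Nat.sub_le n 1)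
  have h2' := (hL.natDegree_lshift_le hα' n).trans (Nat.sub_le n 1)
  have h3 := hL.natDegree_X_mul_lshift_le hα n
  have h3' := hL.natDegree_X_mul_lshift_le hα' n
  have h4 := hL.natDegree_sub_X_mul_le hα n
  simp only [lagQ, mul_assoc]
  fin_cases i <;> fin_cases j
  · exact h1'
  · exact hC _ h1
  · exact h0
  · exact h0
  · exact hC _ h2'
  · exact hadd (hadd (hC _ h3') h1) (hC _ h3)
  · exact hC _ h2
  · exact hC _ h3
  · exact h0
  · exact h4
  · exact h1
  · exact h4
  · exact h0
  · exact hC _ h3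
  · exact hC _ h2
  · exact hadd (hC _ h3) h1

lemma natCast_mul_coeff_X_mul_lshift (hL : IsLaguerreFamily L) (hα : -1 < α) (n : ℕ) :
    (n : ℂ) * (X * lshift (L α) n).coeff n = n := by
  cases n with
  | zero => simp
  | succ n => rw [coeff_X_mul, lshift, hL.coeff_self hα, mul_one]

lemma natCast_mul_coeff_lshift (hL : IsLaguerreFamily L) (hα : -1 < α) (n : ℕ) :
    (n : ℂ) * (lshift (L α) n).coeff n = 0 := by
  cases n with
  | zero => simp
  | succ n =>
    rw [lshift, coeff_eq_zero_of_natDegree_lt, mul_zero]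
    rw [hL.natDegree_eq hα]
    exact n.lt_succ_self

lemma isUnit_leadingCoeff_lagQ (hL : IsLaguerreFamily L) (hα : -1 < α) (n : ℕ) :
    IsUnit (Matrix.of fun i j : Fin 4 => (lagQ α L n i j).coeff n) := by
  have hα' : -1 < α + 1 := by linarith
  have h1 := hL.coeff_self hα n
  have h1' := hL.coeff_self hα' n
  have h2 := hL.natCast_mul_coeff_lshift hα n
  have h2' := hL.natCast_mul_coeff_lshift hα' n
  have h3 := hL.natCast_mul_coeff_X_mul_lshift hα n
  have h3' := hL.natCast_mul_coeff_X_mul_lshift hα' n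
  set c := (L α (n + 1) - X * L α n).coeff n with hc
  set t : ℝ := n * (n + α) with ht
  have h4 : (n : ℂ) * (n + α) * (lshift (L α) n).coeff n = 0 := by
    linear_combination (n + α) * h2
  have h5 : (n : ℂ) * (n + α) * (X * lshift (L α) n).coeff n = t := by
    rw [ht]; push_cast; linear_combination (n + α) * h3
  have ht0 : 0 ≤ t := by
    cases n with
    | zero => simp [ht]
    | succ n =>
      rw [ht]
      push_cast
      have : (0 : ℝ) ≤ n := n.cast_nonneg
      have : 0 ≤ (n : ℝ) + 1 + α := by linarith
      positivity
  have hM : (Matrix.of fun i j : Fin 4 => (lagQ α L n i j).coeff n) =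
      !![1, -((n : ℂ) + α + 1), 0, 0;
         0, n + 1 + t, 0, t;
         0, c, 1, c;
         0, t, 0, t + 1] := by
    ext i j
    simp only [lagQ, mul_assoc (C _)]
    fin_cases i <;> fin_cases j <;>
      simp only [of_apply, cons_val', cons_val_zero, cons_val_one, cons_val, Fin.zero_eta,
        Fin.mk_one, Fin.reduceFinMk, coeff_add, coeff_C_mul, coeff_zero, h1, h1', h3', h4, h5,
        neg_mul, h2', neg_zero, mul_one, ← hc]
  have hdet : (!![1, -((n : ℂ) + α + 1), 0, 0;
         0, n + 1 + t, 0, t;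
         0, c, 1, c;
         0, t, 0, t + 1]).det = ((n + 1 + 2 * t + n * t : ℝ) : ℂ) := by
    simp [det_succ_row_zero, Fin.sum_univ_succ, Fin.succAbove]
    ring
  rw [hM, Matrix.isUnit_iff_isUnit_det, hdet, isUnit_iff_ne_zero, Complex.ofReal_ne_zero]
  positivity

lemma laguerreFunctional_lagQ_mul (hL : IsLaguerreFamily L) (hα : -1 < α) (n : ℕ) (i j : Fin 4)
    (k : ℕ) (hk : k < n) :
    laguerreFunctional α ((lagQ α L n * lagWPoly) i j * X ^ k) = 0 := by
  obtain ⟨n, rfl⟩ := Nat.exists_eq_add_of_le' (Nat.one_le_of_lt hk)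
  have hα' : -1 < α + 1 := by linarith
  set F := laguerreFunctional α
  set G := laguerreFunctional (α + 1)
  set p := L (α + 1) (n + 1) with hp
  set q := L α (n + 1) with hq
  set u := L α (n + 2) with hu
  set r := L (α + 1) n with hr
  set s := L α n with hs
  have hXF : ∀ f, F (X * f) = G f := laguerreFunctional_X_mul α
  have hCF : ∀ a f, F (C a * f) = a * F f := laguerreFunctional_C_mul α
  have hCG : ∀ a f, G (C a * f) = a * G f := laguerreFunctional_C_mul (α + 1)
  have hpk : G (p * X ^ k) = 0 := hL.orthogonal hα' _ _ hk
  have hqk : F (q * X ^ k) = 0 := hL.orthogonal hα _ _ hk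
  have huk : F (u * X ^ k) = 0 := hL.orthogonal hα _ _ (by omega)
  have huk' : F (X * u * X ^ k) = 0 := by
    rw [show X * u * X ^ k = u * X ^ (k + 1) by ring]
    exact hL.orthogonal hα _ _ (by omega)
  have hnr := hL.norm_succ hα n
  have hqs : F ((X * q - C (((n + 1 : ℕ) : ℂ) * (((n + 1 : ℕ) : ℂ) + α)) * s) * X ^ k) = 0 := by
    rw [show (X * q - C (((n + 1 : ℕ) : ℂ) * (((n + 1 : ℕ) : ℂ) + α)) * s) * X ^ k =
      q * X ^ (k + 1) - C (((n + 1 : ℕ) : ℂ) * (((n + 1 : ℕ) : ℂ) + α)) * (s * X ^ k) by ring,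
      map_sub, hCF]
    rcases eq_or_lt_of_le (Nat.le_of_lt_succ hk) with rfl | hk'
    · rw [hnr, hL.norm_add_one hα]
      push_cast
      ring
    · rw [hL.orthogonal hα _ _ hk', hL.orthogonal hα _ _ (by omega)]
      ring
  have hqr : G ((q - C ((n + 1 : ℕ) : ℂ) * r) * X ^ k) = 0 := by
    rw [show (q - C ((n + 1 : ℕ) : ℂ) * r) * X ^ k =
      q * X ^ k - C ((n + 1 : ℕ) : ℂ) * (r * X ^ k) by ring, map_sub, hCG, ← hXF,
      show X * (q * X ^ k) = q * X ^ (k + 1) by ring]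
    rcases eq_or_lt_of_le (Nat.le_of_lt_succ hk) with rfl | hk'
    · rw [hnr]
      push_cast
      ring
    · rw [hL.orthogonal hα' _ _ hk', hL.orthogonal hα _ _ (by omega)]
      ring
  have hpq : ∀ l ≤ n + 1,
      F ((X * p - C (((n + 1 : ℕ) : ℂ) + α + 1) * q) * X ^ l) = 0 := by
    intro l hl
    rw [show (X * p - C (((n + 1 : ℕ) : ℂ) + α + 1) * q) * X ^ l =
      X * (p * X ^ l) - C (((n + 1 : ℕ) : ℂ) + α + 1) * (q * X ^ l) by ring, map_sub, hCF, hXF]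
    rcases eq_or_lt_of_le hl with rfl | hl
    · rw [hL.norm_add_one hα]
      ring
    · rw [hL.orthogonal hα' _ _ hl, hL.orthogonal hα _ _ hl]
      ring
  have hpq0 := hpq k hk.le
  have hpq1 := hpq (k + 1) hk
  have hadd : ∀ {f g : ℂ[X]}, F f = 0 → F g = 0 → F (f + g) = 0 := fun hf hg => by
    rw [map_add, hf, hg, add_zero]
  have key : ∀ f g : ℂ[X], F g = 0 → f = g → F f = 0 := fun f g hg h => h ▸ hg
  have hXp : F (X * (p * X ^ k)) = 0 := (hXF _).trans hpk
  have hXqr := (hXF _).trans hqr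
  simp only [lagQ, lshift, lagWPoly, ← hp, ← hq, ← hu, ← hr, ← hs, Matrix.mul_apply,
    Fin.sum_univ_four]
  fin_cases i <;> fin_cases j <;>
    simp only [of_apply, cons_val', cons_val_zero, cons_val_one, cons_val, Fin.zero_eta,
        Fin.mk_one, Fin.reduceFinMk, C_neg]
  · exact key _ _ (hadd hXp hpq1) (by ring)
  · exact key _ _ hpq0 (by ring)
  · exact key _ _ hpq1 (by ring)
  · exact key _ _ (map_zero F) (by ring)
  · exact key _ _ hXqr (by ring)
  · exact key _ _ hqk (by ring)
  · exact key _ _ hqs (by ring)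
  · exact key _ _ (map_zero F) (by ring)
  · exact key _ _ huk' (by ring)
  · exact key _ _ huk (by ring)
  · exact key _ _ (hadd (hadd huk' huk') hqk) (by ring)
  · exact key _ _ huk (by ring)
  · exact key _ _ (map_zero F) (by ring)
  · exact key _ _ (map_zero F) (by ring)
  · exact key _ _ hqs (by ring)
  · exact key _ _ hqk (by ring)

lemma laguerreFunctional_lagQ_of_lt (hL : IsLaguerreFamily L) (hα : -1 < α) {m n : ℕ}
    (hmn : m < n) (i j : Fin 4) :
    laguerreFunctional α ((lagQ α L n * lagWPoly * conjTransposeM (lagQ α L m)) i j) = 0 := by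
  rw [Matrix.mul_apply, map_sum]
  refine Finset.sum_eq_zero fun k _ => ?_
  refine laguerreFunctional_mul_eq_zero (hL.laguerreFunctional_lagQ_mul hα n i k) ?_
  refine degree_le_natDegree.trans_lt (Nat.cast_lt.2 (lt_of_le_of_lt ?_ hmn))
  exact (natDegree_map_le).trans (hL.natDegree_lagQ_le hα m j k)

end IsLaguerreFamily

/-- `Q_n` is a MOP sequence for the 4×4 Laguerre-type weight `W`. -/
theorem statement_16 (α : ℝ) (hα : -1 < α)
    (L : ℝ → ℕ → Polynomial ℂ) (hL : IsLaguerreFamily L) :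
    IsMOP (Set.Ioi 0) (lagW α) (lagQ α L) := by
  refine ⟨hL.natDegree_lagQ_le hα, hL.isUnit_leadingCoeff_lagQ hα, fun n m i j => ?_,
    fun n m hnm => ?_⟩
  · simp only [lagW_integrand]
    exact (integrableOn_and_integral_eval_mul_laguerre hα _).1
  · ext i j
    rw [innerW_lagW hα, Matrix.zero_apply]
    rcases lt_or_gt_of_ne hnm with h | h
    · rw [laguerreFunctional_conj_symm, hL.laguerreFunctional_lagQ_of_lt hα h, map_zero]
    · exact hL.laguerreFunctional_lagQ_of_lt hα h i j
end
end

section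
/- Let a, b, c ∈ ℝ∖{0}, and for each n ≥ 0 let H_n be the monic degree-n polynomial with ∫_ℝ H_n(x) x^k e^{−x²} dx = 0 for 0 ≤ k < n (with the convention H_{−1} = 0). Let W(x) = e^{−x²}·[[e^{2bx} + a²x², ax, acx²],[ax, 1, cx],[acx², cx, c²x² + 1]] on ℝ. Then the sequence of 3×3 matrix polynomials Q_n(x) with rows (H_n(x−b), a(H_{n+1}(x) − x H_n(x−b)), 0), (−(n a e^{−b²}/2) H_{n−1}(x−b), (n a² e^{−b²}/2) x H_{n−1}(x−b) + H_n(x) + (n c²/2) x H_{n−1}(x), −(c n/2) H_{n−1}(x)), and (0, −c n H_{n−1}(x), 2 H_n(x)) is a sequence of matrix orthogonal polynomials with respect to W. -/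
open MeasureTheory Filter Polynomial Matrix
open scoped ComplexOrder

noncomputable section

/-- `H` is the sequence of monic orthogonal polynomials for the Hermite weight `e^{-x²}`. -/
def IsHermiteSeq (H : ℕ → Polynomial ℂ) : Prop :=
  ∀ n : ℕ, (H n).Monic ∧ (H n).natDegree = n ∧
    ∀ k < n, ∫ x : ℝ, (H n).eval (x : ℂ) * (x : ℂ) ^ k * ((Real.exp (-x ^ 2) : ℝ) : ℂ) = 0

/-- The 3×3 Hermite-type weight of Example 4. -/
def hermW (a b c : ℝ) (x : ℝ) : Matrix (Fin 3) (Fin 3) ℂ :=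
  Complex.exp (-(x : ℂ) ^ 2) •
    !![Complex.exp (2 * (b : ℂ) * (x : ℂ)) + (a : ℂ) ^ 2 * (x : ℂ) ^ 2,
         (a : ℂ) * (x : ℂ), (a : ℂ) * (c : ℂ) * (x : ℂ) ^ 2;
       (a : ℂ) * (x : ℂ), 1, (c : ℂ) * (x : ℂ);
       (a : ℂ) * (c : ℂ) * (x : ℂ) ^ 2, (c : ℂ) * (x : ℂ), (c : ℂ) ^ 2 * (x : ℂ) ^ 2 + 1]

/-- The explicit orthogonal polynomials `Q_n` for the weight of Example 4. -/
def hermQ (a b c : ℝ) (H : ℕ → Polynomial ℂ) (n : ℕ) : MatPoly 3 3 :=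
  !![(H n).comp (X - Polynomial.C (b : ℂ)),
       Polynomial.C (a : ℂ) * (H (n + 1) - X * (H n).comp (X - Polynomial.C (b : ℂ))), 0;
     Polynomial.C (-((n : ℂ) * (a : ℂ) * Complex.exp (-(b : ℂ) ^ 2) / 2)) *
         (lshift H n).comp (X - Polynomial.C (b : ℂ)),
       Polynomial.C ((n : ℂ) * (a : ℂ) ^ 2 * Complex.exp (-(b : ℂ) ^ 2) / 2) * X *
           (lshift H n).comp (X - Polynomial.C (b : ℂ))
         + H n + Polynomial.C ((n : ℂ) * (c : ℂ) ^ 2 / 2) * X * lshift H n,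
       Polynomial.C (-((c : ℂ) * (n : ℂ) / 2)) * lshift H n;
     0, Polynomial.C (-((c : ℂ) * (n : ℂ))) * lshift H n, Polynomial.C 2 * H n]

/-- The monic Hermite polynomials for the weight `e^{-x²}`, by the raising recursion. -/
def monicHermite : ℕ → ℂ[X]
  | 0 => 1
  | n + 1 => X * monicHermite n - C (1 / 2) * derivative (monicHermite n)

theorem derivative_monicHermite_succ (n : ℕ) :
    derivative (monicHermite (n + 1)) = C ((n : ℂ) + 1) * monicHermite n := by
  induction n with
  | zero => simp [monicHermite]
  | succ n ih =>
    have h : monicHermite (n + 1) =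
        X * monicHermite n - C (1 / 2) * derivative (monicHermite n) := rfl
    rw [monicHermite, derivative_sub, derivative_mul, derivative_C_mul, ih, derivative_C_mul]
    simp only [derivative_X, Nat.cast_add, Nat.cast_one, map_add, map_one]
    linear_combination (-(C (n : ℂ) + 1)) * h

theorem derivative_monicHermite (n : ℕ) :
    derivative (monicHermite n) = C (n : ℂ) * lshift monicHermite n := by
  cases n with
  | zero => simp [monicHermite]
  | succ n => simpa [lshift] using derivative_monicHermite_succ n

theorem monicHermite_natDegree_le (n : ℕ) : (monicHermite n).natDegree ≤ n := by
  induction n with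
  | zero => simp [monicHermite]
  | succ n ih =>
    rw [monicHermite]
    refine (natDegree_sub_le _ _).trans (max_le ?_ ?_)
    · exact natDegree_mul_le.trans (by simp only [natDegree_X]; omega)
    · refine (natDegree_C_mul_le _ _).trans ((natDegree_derivative_le _).trans (by omega))

theorem monicHermite_coeff_self (n : ℕ) : (monicHermite n).coeff n = 1 := by
  induction n with
  | zero => simp [monicHermite]
  | succ n ih =>
    have h : (derivative (monicHermite n)).coeff (n + 1) = 0 := by
      refine coeff_eq_zero_of_natDegree_lt ?_
      have := natDegree_derivative_le (monicHermite n)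
      have := monicHermite_natDegree_le n
      omega
    rw [monicHermite, coeff_sub, coeff_X_mul, coeff_C_mul, h, ih]
    simp

theorem monicHermite_map_conj (n : ℕ) :
    (monicHermite n).map (starRingEnd ℂ) = monicHermite n := by
  induction n with
  | zero => simp [monicHermite]
  | succ n ih =>
    rw [monicHermite, Polynomial.map_sub, Polynomial.map_mul, Polynomial.map_mul,
      ← derivative_map, ih, map_X, map_C, map_div₀, map_one, map_ofNat]

theorem integrable_eval_mul_gaussian (p : ℂ[X]) :
    Integrable fun x : ℝ => p.eval (x : ℂ) * ((Real.exp (-x ^ 2) : ℝ) : ℂ) := by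
  induction p using Polynomial.induction_on' with
  | add p q hp hq => exact (hp.add hq).congr (ae_of_all _ fun x => by simp [add_mul])
  | monomial n r =>
    have h := integrable_rpow_mul_exp_neg_mul_sq (b := 1) one_pos (s := (n : ℝ))
      (by have : (0 : ℝ) ≤ n := n.cast_nonneg
          linarith)
    refine (h.ofReal (𝕜 := ℂ)).const_mul r |>.congr (ae_of_all _ fun x => ?_)
    simp [mul_assoc]

/-- Integration of polynomials against `e^{-x²}`. -/
def gaussianFunctional : ℂ[X] →ₗ[ℂ] ℂ where
  toFun p := ∫ x : ℝ, p.eval (x : ℂ) * ((Real.exp (-x ^ 2) : ℝ) : ℂ)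
  map_add' p q := by
    simp only [eval_add, add_mul]
    exact integral_add (integrable_eval_mul_gaussian p) (integrable_eval_mul_gaussian q)
  map_smul' r p := by
    simp only [eval_smul, smul_eq_mul, mul_assoc, RingHom.id_apply]
    exact integral_const_mul _ _

theorem gaussianFunctional_apply (p : ℂ[X]) :
    gaussianFunctional p = ∫ x : ℝ, p.eval (x : ℂ) * ((Real.exp (-x ^ 2) : ℝ) : ℂ) := rfl

theorem gaussianFunctional_C_mul (r : ℂ) (p : ℂ[X]) :
    gaussianFunctional (C r * p) = r * gaussianFunctional p := by
  rw [← smul_eq_C_mul, map_smul, smul_eq_mul]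

theorem gaussianFunctional_one_ne_zero : gaussianFunctional 1 ≠ 0 := by
  have h := integral_gaussian 1
  simp only [neg_mul, one_mul, div_one] at h
  rw [gaussianFunctional_apply]
  simp only [eval_one, one_mul]
  rw [integral_complex_ofReal, h]
  exact_mod_cast (Real.sqrt_pos.mpr Real.pi_pos).ne'

theorem gaussianFunctional_derivative (p : ℂ[X]) :
    gaussianFunctional (derivative p) = gaussianFunctional (C 2 * X * p) := by
  rw [← sub_eq_zero, ← map_sub, gaussianFunctional_apply]
  refine integral_eq_zero_of_hasDerivAt_of_integrable
    (f := fun x : ℝ => p.eval (x : ℂ) * ((Real.exp (-x ^ 2) : ℝ) : ℂ)) (fun x => ?_)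
    (integrable_eval_mul_gaussian _) (integrable_eval_mul_gaussian _)
  have h1 : HasDerivAt (fun x : ℝ => p.eval (x : ℂ)) ((derivative p).eval (x : ℂ)) x :=
    (p.hasDerivAt (x : ℂ)).comp_ofReal
  have h2 : HasDerivAt (fun x : ℝ => ((Real.exp (-x ^ 2) : ℝ) : ℂ))
      ((Real.exp (-x ^ 2) * (-(2 * x)) : ℝ) : ℂ) x := by
    have := ((hasDerivAt_pow 2 x).neg.exp).ofReal_comp
    simpa using this
  refine (h1.mul h2).congr_deriv ?_
  simp only [eval_sub, eval_mul, eval_C, eval_X, Complex.ofReal_mul, Complex.ofReal_neg,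
    Complex.ofReal_ofNat]
  ring

theorem gaussianFunctional_monicHermite_succ_mul (n : ℕ) (p : ℂ[X]) :
    gaussianFunctional (monicHermite (n + 1) * p) =
      1 / 2 * gaussianFunctional (monicHermite n * derivative p) := by
  have h := gaussianFunctional_derivative (monicHermite n * p)
  rw [derivative_mul, map_add, mul_assoc, gaussianFunctional_C_mul] at h
  rw [monicHermite, sub_mul, map_sub, mul_assoc, mul_assoc, gaussianFunctional_C_mul]
  linear_combination (-1 / 2) * h

theorem gaussianFunctional_monicHermite_mul_of_natDegree_lt (n : ℕ) :
    ∀ p : ℂ[X], p.natDegree < n → gaussianFunctional (monicHermite n * p) = 0 := by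
  induction n with
  | zero => intro p hp; omega
  | succ n ih =>
    intro p hp
    rw [gaussianFunctional_monicHermite_succ_mul]
    rcases Nat.eq_zero_or_pos p.natDegree with h0 | h0
    · rw [derivative_of_natDegree_zero h0]; simp
    · rw [ih _ ((natDegree_derivative_lt h0.ne').trans_le (by omega)), mul_zero]

theorem gaussianFunctional_monicHermite_mul_of_ne {n m : ℕ} (h : n ≠ m) :
    gaussianFunctional (monicHermite n * monicHermite m) = 0 := by
  rcases lt_or_gt_of_ne h with h | h
  · rw [mul_comm]
    exact gaussianFunctional_monicHermite_mul_of_natDegree_lt _ _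
      ((monicHermite_natDegree_le n).trans_lt h)
  · exact gaussianFunctional_monicHermite_mul_of_natDegree_lt _ _
      ((monicHermite_natDegree_le m).trans_lt h)

theorem gaussianFunctional_monicHermite_succ_mul_self (n : ℕ) :
    gaussianFunctional (monicHermite (n + 1) * monicHermite (n + 1)) =
      ((n : ℂ) + 1) / 2 * gaussianFunctional (monicHermite n * monicHermite n) := by
  rw [gaussianFunctional_monicHermite_succ_mul, derivative_monicHermite_succ, mul_left_comm,
    gaussianFunctional_C_mul]
  ring

theorem gaussianFunctional_monicHermite_mul_self_ne_zero (n : ℕ) :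
    gaussianFunctional (monicHermite n * monicHermite n) ≠ 0 := by
  induction n with
  | zero => simpa [monicHermite] using gaussianFunctional_one_ne_zero
  | succ n ih =>
    rw [gaussianFunctional_monicHermite_succ_mul_self]
    exact mul_ne_zero (div_ne_zero (by exact_mod_cast n.succ_ne_zero) two_ne_zero) ih

theorem IsHermiteSeq.gaussianFunctional_mul_eq_zero {H : ℕ → ℂ[X]} (hH : IsHermiteSeq H) {n : ℕ}
    {p : ℂ[X]} (hp : p.natDegree < n) : gaussianFunctional (H n * p) = 0 := by
  rw [p.as_sum_range_C_mul_X_pow, Finset.mul_sum, map_sum]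
  refine Finset.sum_eq_zero fun k hk => ?_
  rw [mul_left_comm, gaussianFunctional_C_mul, gaussianFunctional_apply]
  simp only [eval_mul, eval_pow, eval_X]
  rw [(hH n).2.2 k (by have := Finset.mem_range.mp hk; omega), mul_zero]

theorem IsHermiteSeq.eq_monicHermite {H : ℕ → ℂ[X]} (hH : IsHermiteSeq H) :
    H = monicHermite := by
  funext n
  by_contra hne
  set d := H n - monicHermite n with hd
  have hd0 : d ≠ 0 := sub_ne_zero.mpr hne
  have hHc : (H n).coeff n = 1 := by
    have := (hH n).1.coeff_natDegree
    rwa [(hH n).2.1] at this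
  have hle : d.natDegree ≤ n :=
    (natDegree_sub_le _ _).trans (max_le (hH n).2.1.le (monicHermite_natDegree_le n))
  have hlt : d.natDegree < n := by
    refine lt_of_le_of_ne hle fun h => hd0 (leadingCoeff_eq_zero.mp ?_)
    rw [leadingCoeff, h, hd, coeff_sub, hHc, monicHermite_coeff_self, sub_self]
  set m := d.natDegree with hm
  have h0 : gaussianFunctional (d * monicHermite m) = 0 := by
    have hG := (monicHermite_natDegree_le m).trans_lt hlt
    rw [hd, sub_mul, map_sub, hH.gaussianFunctional_mul_eq_zero hG,
      gaussianFunctional_monicHermite_mul_of_natDegree_lt _ _ hG, sub_zero]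
  have h1 : gaussianFunctional (monicHermite m * (d - C d.leadingCoeff * monicHermite m)) = 0 := by
    rcases Nat.eq_zero_or_pos m with hm0 | hm0
    · have : d - C d.leadingCoeff * monicHermite m = 0 := by
        rw [hm0, leadingCoeff, ← hm, hm0, monicHermite, mul_one,
          ← eq_C_of_natDegree_eq_zero (hm.symm.trans hm0), sub_self]
      simp [this]
    · refine gaussianFunctional_monicHermite_mul_of_natDegree_lt _ _ ?_
      refine lt_of_le_of_lt (natDegree_le_pred (n := m) ?_ ?_) (Nat.sub_lt hm0 one_pos)
      · exact (natDegree_sub_le _ _).trans (max_le le_rfl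
          ((natDegree_C_mul_le _ _).trans (monicHermite_natDegree_le m)))
      · rw [coeff_sub, coeff_C_mul, monicHermite_coeff_self, leadingCoeff]
        simp [hm]
  rw [mul_sub, map_sub, mul_left_comm, gaussianFunctional_C_mul, mul_comm, h0, zero_sub,
    neg_eq_zero] at h1
  exact (mul_ne_zero (leadingCoeff_ne_zero.mpr hd0)
    (gaussianFunctional_monicHermite_mul_self_ne_zero m)) h1

theorem monicHermite_succ_eq (n : ℕ) :
    monicHermite (n + 1) =
      X * monicHermite n - C ((n : ℂ) / 2) * lshift monicHermite n := by
  rw [monicHermite, derivative_monicHermite, ← mul_assoc, ← C_mul]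
  congr 3
  ring

/-- The unipotent factor of `hermW`. -/
def hermT (a c x : ℝ) : Matrix (Fin 3) (Fin 3) ℂ :=
  !![1, (a : ℂ) * x, 0; 0, 1, 0; 0, (c : ℂ) * x, 1]

/-- The diagonal factor of `hermW`. -/
def hermD (b x : ℝ) : Matrix (Fin 3) (Fin 3) ℂ :=
  Complex.exp (-(x : ℂ) ^ 2) • !![Complex.exp (2 * (b : ℂ) * (x : ℂ)), 0, 0; 0, 1, 0; 0, 0, 1]

theorem hermW_eq (a b c x : ℝ) : hermW a b c x = hermT a c x * hermD b x * (hermT a c x)ᴴ := by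
  ext i j
  fin_cases i <;> fin_cases j <;>
    simp [hermW, hermT, hermD, Matrix.mul_apply, Fin.sum_univ_three] <;> ring

/-- The entries of `hermQ · hermT`, with the first column translated by `b`. -/
def hermR (a b c : ℝ) (n : ℕ) : MatPoly 3 3 :=
  !![monicHermite n, C (a : ℂ) * monicHermite (n + 1), 0;
     C (-((n : ℂ) * (a : ℂ) * Complex.exp (-(b : ℂ) ^ 2) / 2)) * lshift monicHermite n,
       monicHermite n, C (-((c : ℂ) * (n : ℂ) / 2)) * lshift monicHermite n;
     0, C (2 * (c : ℂ)) * monicHermite (n + 1), C 2 * monicHermite n]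

theorem lshift_monicHermite_map_conj (n : ℕ) :
    (lshift monicHermite n).map (starRingEnd ℂ) = lshift monicHermite n := by
  cases n with
  | zero => simp [lshift]
  | succ n => exact monicHermite_map_conj n

theorem hermR_map_conj (a b c : ℝ) (n : ℕ) (i j : Fin 3) :
    (hermR a b c n i j).map (starRingEnd ℂ) = hermR a b c n i j := by
  have h2 : (starRingEnd ℂ) 2 = 2 := map_ofNat _ 2
  fin_cases i <;> fin_cases j <;>
    simp [hermR, h2, monicHermite_map_conj, lshift_monicHermite_map_conj, ← Complex.exp_conj]

theorem star_eval_hermR (a b c : ℝ) (n : ℕ) (i j : Fin 3) (x : ℝ) :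
    star ((hermR a b c n i j).eval (x : ℂ)) = (hermR a b c n i j).eval (x : ℂ) := by
  have h := eval_map_apply (starRingEnd ℂ) (p := hermR a b c n i j) (x : ℂ)
  rw [hermR_map_conj, Complex.conj_ofReal] at h
  exact h.symm

theorem evalM_hermQ_mul_hermT (a b c : ℝ) (n : ℕ) (x : ℝ) :
    evalM (hermQ a b c monicHermite n) x * hermT a c x =
      Matrix.of fun i j => (hermR a b c n i j).eval (((if j = 0 then x - b else x) : ℝ) : ℂ) := by
  ext i j
  fin_cases i <;> fin_cases j <;>
    simp [evalM, hermQ, hermT, hermR, Matrix.mul_apply, Fin.sum_univ_three,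
      monicHermite_succ_eq n] <;> ring

theorem hermQ_mul_hermW_mul_hermQ_apply (a b c : ℝ) (n m : ℕ) (i j : Fin 3) (x : ℝ) :
    (evalM (hermQ a b c monicHermite n) x * hermW a b c x *
        (evalM (hermQ a b c monicHermite m) x)ᴴ) i j =
      Complex.exp ((b : ℂ) ^ 2) *
        ((hermR a b c n i 0 * hermR a b c m j 0).eval (((x - b : ℝ)) : ℂ) *
          ((Real.exp (-(x - b) ^ 2) : ℝ) : ℂ)) +
      (hermR a b c n i 1 * hermR a b c m j 1 + hermR a b c n i 2 * hermR a b c m j 2).eval (x : ℂ) *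
        ((Real.exp (-x ^ 2) : ℝ) : ℂ) := by
  have hexp : Complex.exp (-(x : ℂ) ^ 2) * Complex.exp (2 * (b : ℂ) * (x : ℂ)) =
      Complex.exp ((b : ℂ) ^ 2) * ((Real.exp (-(x - b) ^ 2) : ℝ) : ℂ) := by
    push_cast
    rw [← Complex.exp_add, ← Complex.exp_add]
    congr 1
    ring
  have hexp' : ((Real.exp (-x ^ 2) : ℝ) : ℂ) = Complex.exp (-(x : ℂ) ^ 2) := by push_cast; rfl
  have hfac : evalM (hermQ a b c monicHermite n) x * hermW a b c x *
        (evalM (hermQ a b c monicHermite m) x)ᴴ =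
      (evalM (hermQ a b c monicHermite n) x * hermT a c x) * hermD b x *
        (evalM (hermQ a b c monicHermite m) x * hermT a c x)ᴴ := by
    rw [hermW_eq, conjTranspose_mul]
    simp only [Matrix.mul_assoc]
  rw [hfac, evalM_hermQ_mul_hermT, evalM_hermQ_mul_hermT, hexp']
  simp only [Matrix.mul_apply, Fin.sum_univ_three, conjTranspose_apply, Matrix.of_apply,
    star_eval_hermR, hermD, Matrix.smul_apply, smul_eq_mul, eval_mul, eval_add]
  simp only [Fin.isValue, Matrix.cons_val, if_true, one_ne_zero, if_false,
    Fin.reduceEq, mul_zero, mul_one, add_zero, zero_add]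
  linear_combination ((hermR a b c n i 0).eval (((x - b : ℝ)) : ℂ)) *
    ((hermR a b c m j 0).eval (((x - b : ℝ)) : ℂ)) * hexp

theorem integrable_eval_mul_gaussian_sub (p : ℂ[X]) (b : ℝ) :
    Integrable fun x : ℝ => p.eval ((x - b : ℝ) : ℂ) * ((Real.exp (-(x - b) ^ 2) : ℝ) : ℂ) :=
  (integrable_eval_mul_gaussian p).comp_sub_right b

theorem integral_hermQ_mul_hermW_mul_hermQ (a b c : ℝ) (n m : ℕ) (i j : Fin 3) :
    ∫ x : ℝ, (evalM (hermQ a b c monicHermite n) x * hermW a b c x *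
        (evalM (hermQ a b c monicHermite m) x)ᴴ) i j =
      Complex.exp ((b : ℂ) ^ 2) * gaussianFunctional (hermR a b c n i 0 * hermR a b c m j 0) +
        (gaussianFunctional (hermR a b c n i 1 * hermR a b c m j 1) +
          gaussianFunctional (hermR a b c n i 2 * hermR a b c m j 2)) := by
  simp only [hermQ_mul_hermW_mul_hermQ_apply]
  rw [integral_add ((integrable_eval_mul_gaussian_sub _ b).const_mul _)
    (integrable_eval_mul_gaussian _), integral_const_mul,
    integral_sub_right_eq_self (fun x : ℝ =>
      (hermR a b c n i 0 * hermR a b c m j 0).eval (x : ℂ) * ((Real.exp (-x ^ 2) : ℝ) : ℂ)) b,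
    ← map_add]
  rfl

theorem gaussianFunctional_hermR_eq_zero (a b c : ℝ) {n m : ℕ} (h : n ≠ m) (i j : Fin 3) :
    Complex.exp ((b : ℂ) ^ 2) * gaussianFunctional (hermR a b c n i 0 * hermR a b c m j 0) +
      (gaussianFunctional (hermR a b c n i 1 * hermR a b c m j 1) +
        gaussianFunctional (hermR a b c n i 2 * hermR a b c m j 2)) = 0 := by
  have hl (r : ℂ) (p q : ℂ[X]) : gaussianFunctional (C r * p * q) =
      r * gaussianFunctional (p * q) := by rw [mul_assoc, gaussianFunctional_C_mul]
  have hr (r : ℂ) (p q : ℂ[X]) : gaussianFunctional (p * (C r * q)) =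
      r * gaussianFunctional (p * q) := by rw [mul_left_comm, gaussianFunctional_C_mul]
  have hS {n m : ℕ} (h : n ≠ m) :
      gaussianFunctional (lshift monicHermite n * lshift monicHermite m) = 0 := by
    cases n <;> cases m <;> simp only [lshift, zero_mul, mul_zero, map_zero]
    exact gaussianFunctional_monicHermite_mul_of_ne (by omega)
  have hE : Complex.exp ((b : ℂ) ^ 2) * Complex.exp (-(b : ℂ) ^ 2) = 1 := by
    rw [← Complex.exp_add]; simp
  have hO := gaussianFunctional_monicHermite_mul_of_ne h
  have hO' := gaussianFunctional_monicHermite_mul_of_ne (n := n + 1) (m := m + 1) (by omega)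
  have hA (k l : ℕ) : gaussianFunctional (monicHermite (k + 1) * monicHermite l) =
      (l : ℂ) / 2 * gaussianFunctional (monicHermite k * lshift monicHermite l) := by
    rw [gaussianFunctional_monicHermite_succ_mul, derivative_monicHermite, hr]
    ring
  have hB (k l : ℕ) : gaussianFunctional (monicHermite l * monicHermite (k + 1)) =
      (l : ℂ) / 2 * gaussianFunctional (lshift monicHermite l * monicHermite k) := by
    rw [mul_comm, hA, mul_comm (monicHermite k)]
  fin_cases i <;> fin_cases j <;>
    simp only [hermR, Fin.zero_eta, Fin.mk_one, Fin.reduceFinMk, Fin.isValue, Matrix.cons_val,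
      Matrix.of_apply, zero_mul, mul_zero, map_zero, hl, hr, hS h, hO, hO', add_zero, zero_add]
  · rw [hA]
    linear_combination (-(m * a / 2) *
      gaussianFunctional (monicHermite n * lshift monicHermite m)) * hE
  · rw [hB]
    linear_combination (-(n * a / 2) *
      gaussianFunctional (lshift monicHermite n * monicHermite m)) * hE
  · rw [hB]
    ring
  · rw [hA]
    ring

theorem lshift_monicHermite_natDegree_le (n : ℕ) :
    (lshift monicHermite n).natDegree ≤ n - 1 := by
  cases n with
  | zero => simp [lshift]
  | succ n => exact monicHermite_natDegree_le n

theorem natDegree_C_mul_X_mul_le {p : ℂ[X]} {n : ℕ} (hp : p.natDegree ≤ n - 1)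
    (h0 : n = 0 → p = 0) (r : ℂ) : (C r * X * p).natDegree ≤ n := by
  rcases Nat.eq_zero_or_pos n with h | h
  · simp [h0 h]
  · rw [mul_assoc]
    refine (natDegree_C_mul_le _ _).trans (natDegree_mul_le.trans ?_)
    rw [natDegree_X]
    omega

theorem natDegree_comp_X_sub_C_le {p : ℂ[X]} {n : ℕ} (hp : p.natDegree ≤ n) (r : ℂ) :
    (p.comp (X - C r)).natDegree ≤ n := by
  rwa [natDegree_comp, natDegree_X_sub_C, mul_one]

theorem monicHermite_comp_coeff_self (n : ℕ) (r : ℂ) :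
    ((monicHermite n).comp (X - C r)).coeff n = 1 := by
  have hm : (monicHermite n).Monic :=
    monic_of_natDegree_le_of_coeff_eq_one n (monicHermite_natDegree_le n)
      (monicHermite_coeff_self n)
  have hn : (monicHermite n).natDegree = n :=
    le_antisymm (monicHermite_natDegree_le n)
      (le_natDegree_of_ne_zero (by rw [monicHermite_coeff_self]; exact one_ne_zero))
  have h := (hm.comp_X_sub_C r).coeff_natDegree
  rwa [natDegree_comp, natDegree_X_sub_C, mul_one, hn] at h

theorem hermQ_natDegree_le (a b c : ℝ) (n : ℕ) (i j : Fin 3) :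
    (hermQ a b c monicHermite n i j).natDegree ≤ n := by
  have hG := monicHermite_natDegree_le n
  have hl := lshift_monicHermite_natDegree_le n
  have hl' := hl.trans (Nat.sub_le n 1)
  have h0 : n = 0 → lshift monicHermite n = 0 := by rintro rfl; rfl
  have h01 : (monicHermite (n + 1) - X * (monicHermite n).comp (X - C (b : ℂ))).natDegree ≤ n := by
    refine natDegree_le_pred (n := n + 1) ((natDegree_sub_le _ _).trans (max_le
      (monicHermite_natDegree_le _) (natDegree_mul_le.trans ?_))) ?_
    · have := natDegree_comp_X_sub_C_le hG (b : ℂ)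
      rw [natDegree_X]
      omega
    · rw [coeff_sub, coeff_X_mul, monicHermite_coeff_self, monicHermite_comp_coeff_self, sub_self]
  fin_cases i <;> fin_cases j <;>
    simp only [hermQ, Fin.zero_eta, Fin.mk_one, Fin.reduceFinMk, Fin.isValue, Matrix.cons_val,
      Matrix.of_apply, natDegree_zero, zero_le]
  · exact natDegree_comp_X_sub_C_le hG _
  · exact (natDegree_C_mul_le _ _).trans h01
  · exact (natDegree_C_mul_le _ _).trans (natDegree_comp_X_sub_C_le hl' _)
  · exact natDegree_add_le_of_degree_le (natDegree_add_le_of_degree_le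
      (natDegree_C_mul_X_mul_le (natDegree_comp_X_sub_C_le hl _)
        (fun h => by rw [h0 h, zero_comp]) _) hG)
      (natDegree_C_mul_X_mul_le hl h0 _)
  · exact (natDegree_C_mul_le _ _).trans hl'
  · exact (natDegree_C_mul_le _ _).trans hl'
  · exact (natDegree_C_mul_le _ _).trans hG

theorem isUnit_hermQ_leading (a b c : ℝ) (n : ℕ) :
    IsUnit (Matrix.of fun i j : Fin 3 => (hermQ a b c monicHermite n i j).coeff n) := by
  have hl : (lshift monicHermite n).coeff n = 0 := by
    cases n with
    | zero => simp [lshift]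
    | succ n =>
      exact coeff_eq_zero_of_natDegree_lt
        ((monicHermite_natDegree_le n).trans_lt n.lt_succ_self)
  have hlc : ((lshift monicHermite n).comp (X - C (b : ℂ))).coeff n = 0 := by
    cases n with
    | zero => simp [lshift]
    | succ n =>
      exact coeff_eq_zero_of_natDegree_lt
        ((natDegree_comp_X_sub_C_le (monicHermite_natDegree_le n) _).trans_lt n.lt_succ_self)
  have hX : (n : ℂ) * (X * lshift monicHermite n).coeff n = n := by
    cases n with
    | zero => simp
    | succ n => rw [coeff_X_mul, lshift, monicHermite_coeff_self, mul_one]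
  have hXc : (n : ℂ) * (X * (lshift monicHermite n).comp (X - C (b : ℂ))).coeff n = n := by
    cases n with
    | zero => simp
    | succ n => rw [coeff_X_mul, lshift, monicHermite_comp_coeff_self, mul_one]
  rw [Matrix.isUnit_iff_isUnit_det, isUnit_iff_ne_zero, Matrix.det_fin_three]
  simp only [hermQ, Fin.isValue, Matrix.cons_val, Matrix.of_apply, coeff_zero,
    mul_assoc (C _), coeff_add, coeff_C_mul, hl, hlc, monicHermite_coeff_self,
    monicHermite_comp_coeff_self, mul_zero, zero_mul, sub_zero, add_zero, mul_one, one_mul]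
  have hpos : (0 : ℝ) < n * a ^ 2 * Real.exp (-b ^ 2) / 2 + 1 + n * c ^ 2 / 2 := by positivity
  have hne : (((n * a ^ 2 * Real.exp (-b ^ 2) / 2 + 1 + n * c ^ 2 / 2 : ℝ)) : ℂ) * 2 ≠ 0 :=
    mul_ne_zero (Complex.ofReal_ne_zero.mpr hpos.ne') two_ne_zero
  convert hne using 1
  push_cast
  linear_combination ((a : ℂ) ^ 2 * Complex.exp (-(b : ℂ) ^ 2)) * hXc + (c : ℂ) ^ 2 * hX

/-- `Q_n` is a MOP sequence for the 3×3 Hermite-type weight. -/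
theorem statement_18 (a b c : ℝ) (ha : a ≠ 0) (hb : b ≠ 0) (hc : c ≠ 0)
    (H : ℕ → Polynomial ℂ) (hH : IsHermiteSeq H) :
    IsMOP Set.univ (hermW a b c) (hermQ a b c H) := by
  rw [hH.eq_monicHermite]
  refine ⟨hermQ_natDegree_le a b c, isUnit_hermQ_leading a b c, fun n m i j => ?_,
    fun n m h => ?_⟩
  · rw [integrableOn_univ]
    simp only [hermQ_mul_hermW_mul_hermQ_apply]
    exact ((integrable_eval_mul_gaussian_sub _ b).const_mul _).add
      (integrable_eval_mul_gaussian _)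
  · ext i j
    rw [innerW, Matrix.of_apply, setIntegral_univ, integral_hermQ_mul_hermW_mul_hermQ,
      gaussianFunctional_hermR_eq_zero a b c h, Matrix.zero_apply]
end
end

section
/- Let a, b, c ∈ ℝ∖{0} and let W(x) = e^{−x²}·[[e^{2bx} + a²x², ax, acx²],[ax, 1, cx],[acx², cx, c²x² + 1]] on ℝ, with MOP sequence {P_n}. Let w be a good-enough scalar weight supported on ℝ such that neither x ↦ e^{−x²} w(x)^{−1} nor x ↦ e^{−x²+2bx} w(x)^{−1} coincides on ℝ with a rational function. Then D(w, W) = {0}; that is, the only 1×3 matrix differential operator T with polynomial coefficients satisfying p_n·T = A_n·P_n for all n ≥ 0 (for some 1×3 matrices A_n), where {p_n} is a sequence of orthogonal polynomials for w, is T = 0. -/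
open MeasureTheory Filter Polynomial Matrix
open scoped ComplexOrder

noncomputable section

/-- `f` coincides with a rational function. -/
def CoincidesRational (f : ℝ → ℂ) : Prop :=
  ∃ p q : Polynomial ℂ, q ≠ 0 ∧
    ∀ x : ℝ, q.eval (x : ℂ) ≠ 0 → f x = p.eval (x : ℂ) / q.eval (x : ℂ)


/-- The polynomial with conjugated coefficients. -/
abbrev conjP (q : ℂ[X]) : ℂ[X] := q.map (starRingEnd ℂ)

lemma mop_orthogonal_of_degree_lt {N : ℕ} (M : Fin N → Fin N → (ℂ[X] →ₗ[ℂ] ℂ))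
    (P : ℕ → MatPoly N N) (hdeg : ∀ n (i j : Fin N), ((P n) i j).natDegree ≤ n)
    (hlead : ∀ n, IsUnit (Matrix.of fun i j : Fin N => ((P n) i j).coeff n))
    (horth : ∀ n m, n ≠ m → ∀ i j, ∑ k, ∑ l, M k l (P n i k * conjP (P m j l)) = 0) (n : ℕ) :
    ∀ k ≤ n, ∀ Q : MatPoly N N, (∀ i j, (Q i j).degree < (k : WithBot ℕ)) →
      ∀ i j, ∑ r, ∑ l, M r l (P n i r * conjP (Q j l)) = 0 := by
  intro k
  induction k with
  | zero =>
    intro _ Q hQ i j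
    have h0 : ∀ i j, Q i j = 0 := fun i j => by
      have := hQ i j
      rw [Nat.cast_zero] at this
      by_contra h
      exact absurd (Polynomial.zero_le_degree_iff.2 h) (not_le.2 this)
    simp [h0]
  | succ k ih =>
    intro hk Q hQ i j
    obtain ⟨U, hU⟩ := hlead k
    set B : Matrix (Fin N) (Fin N) ℂ :=
      (Matrix.of fun i j : Fin N => (Q i j).coeff k) * (↑U⁻¹ : Matrix (Fin N) (Fin N) ℂ) with hB
    have hBU : B * (Matrix.of fun i j : Fin N => ((P k) i j).coeff k) =
        Matrix.of fun i j : Fin N => (Q i j).coeff k := by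
      rw [← hU, hB, Matrix.mul_assoc, Units.inv_mul, Matrix.mul_one]
    set Q' : MatPoly N N := Matrix.of fun i j => Q i j - ∑ s, C (B i s) * P k s j with hQ'
    have hQ'deg : ∀ i j, (Q' i j).degree < (k : WithBot ℕ) := by
      intro i j
      rw [Polynomial.degree_lt_iff_coeff_zero]
      intro m hm
      have hc := congrFun (congrFun hBU i) j
      simp only [Matrix.mul_apply, Matrix.of_apply] at hc
      simp only [hQ', Matrix.of_apply, coeff_sub, finsetSum_coeff, coeff_C_mul]
      rcases hm.eq_or_lt with rfl | hm
      · rw [hc, sub_self]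
      · have h1 : (Q i j).coeff m = 0 :=
          (Polynomial.degree_lt_iff_coeff_zero _ _).1 (hQ i j) m hm
        have h2 : ∀ s, (P k s j).coeff m = 0 := fun s =>
          coeff_eq_zero_of_natDegree_lt ((hdeg k s j).trans_lt hm)
        simp [h1, h2]
    have h1 := ih (by omega) Q' hQ'deg i j
    have hsplit : ∀ l, conjP (Q j l) = conjP (Q' j l) +
        ∑ s, C (starRingEnd ℂ (B j s)) * conjP (P k s l) := by
      intro l
      simp [hQ', conjP, Polynomial.map_sum]
    have hmove : ∀ r l, M r l (P n i r * conjP (Q j l)) =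
        M r l (P n i r * conjP (Q' j l)) +
          ∑ s, starRingEnd ℂ (B j s) * M r l (P n i r * conjP (P k s l)) := by
      intro r l
      rw [hsplit l, mul_add, map_add, Finset.mul_sum, map_sum]
      congr 1
      refine Finset.sum_congr rfl fun s _ => ?_
      rw [mul_left_comm, ← smul_eq_C_mul, map_smul, smul_eq_mul]
    simp only [hmove, Finset.sum_add_distrib, h1, zero_add]
    have hswap : ∑ r, ∑ l, ∑ s, starRingEnd ℂ (B j s) * M r l (P n i r * conjP (P k s l)) =
        ∑ s, starRingEnd ℂ (B j s) * ∑ r, ∑ l, M r l (P n i r * conjP (P k s l)) := by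
      simp only [Finset.mul_sum]
      rw [Finset.sum_comm_cycle]
    rw [hswap]
    simp [horth n k (by omega)]

lemma linearMap_eq_zero_of_degree_basis (p : ℕ → ℂ[X]) (hdeg : ∀ n, (p n).natDegree ≤ n)
    (hlead : ∀ n, (p n).coeff n ≠ 0) (L : ℂ[X] →ₗ[ℂ] ℂ) (hL : ∀ n, L (p n) = 0) (q : ℂ[X]) :
    L q = 0 := by
  have key : ∀ k : ℕ, ∀ q : ℂ[X], q.degree < (k : WithBot ℕ) → L q = 0 := by
    intro k
    induction k with
    | zero =>
      intro q hq
      have : q = 0 := by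
        by_contra h
        exact absurd (Polynomial.zero_le_degree_iff.2 h) (not_le.2 (by simpa using hq))
      simp [this]
    | succ k ih =>
      intro q hq
      have h := ih (q - (q.coeff k / (p k).coeff k) • p k) (by
        rw [Polynomial.degree_lt_iff_coeff_zero]
        intro m hm
        rcases hm.eq_or_lt with rfl | hm
        · simp [hlead]
        · have h1 : q.coeff m = 0 := (Polynomial.degree_lt_iff_coeff_zero _ _).1 hq m hm
          have h2 := coeff_eq_zero_of_natDegree_lt ((hdeg k).trans_lt hm)
          simp [h1, h2])
      simpa [hL] using h
  exact key (q.natDegree + 1) q (by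
    refine (degree_le_natDegree).trans_lt ?_
    exact_mod_cast Nat.lt_succ_self _)

lemma exists_representing_polynomial (m : ℂ[X] →ₗ[ℂ] ℂ) (p : ℕ → ℂ[X])
    (hdeg : ∀ n, (p n).natDegree ≤ n) (hlead : ∀ n, (p n).coeff n ≠ 0)
    (horth : ∀ n k, n ≠ k → m (p n * conjP (p k)) = 0)
    (hpos : ∀ n, m (p n * conjP (p n)) ≠ 0) :
    ∀ (K : ℕ) (L : ℂ[X] →ₗ[ℂ] ℂ), (∀ n, K ≤ n → L (p n) = 0) → ∃ v, ∀ q, L q = m (q * v) := by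
  intro K
  induction K with
  | zero =>
    intro L hL
    refine ⟨0, fun q => ?_⟩
    rw [linearMap_eq_zero_of_degree_basis p hdeg hlead L (fun n => hL n n.zero_le) q]
    simp
  | succ K ih =>
    intro L hL
    set c := L (p K) / m (p K * conjP (p K))
    obtain ⟨v, hv⟩ := ih (L - c • (m ∘ₗ LinearMap.mulRight ℂ (conjP (p K)))) (by
      intro n hn
      rcases hn.eq_or_lt with rfl | hn
      · simp [c, hpos]
      · simp [hL n hn, horth n K hn.ne'])
    refine ⟨v + c • conjP (p K), fun q => ?_⟩
    have h := hv q
    simp only [LinearMap.sub_apply, LinearMap.smul_apply, LinearMap.comp_apply,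
      LinearMap.mulRight_apply] at h
    rw [mul_add, map_add, ← h, mul_smul_comm, map_smul]
    ring

lemma iterate_derivative_X_mul' (j : ℕ) (q : ℂ[X]) :
    (⇑derivative)^[j] (X * q) = X * (⇑derivative)^[j] q + (j : ℂ[X]) * (⇑derivative)^[j - 1] q := by
  induction j with
  | zero => simp
  | succ j ih =>
    rw [Function.iterate_succ_apply', ih]
    rcases j with _ | j
    · simp; ring
    · simp only [derivative_add, derivative_mul, derivative_X, Nat.add_sub_cancel,
        derivative_natCast, Function.iterate_succ_apply']
      push_cast
      ring

lemma leading_coeff_adjointable {N : ℕ} (M : Fin N → Fin N → (ℂ[X] →ₗ[ℂ] ℂ))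
    (m : ℂ[X] →ₗ[ℂ] ℂ) : ∀ (s : ℕ) (G : ℕ → Fin N → ℂ[X]),
    (∀ (k : ℕ) (i : Fin N), ∃ v : ℂ[X], ∀ q : ℂ[X],
      ∑ l, M l i ((∑ j ∈ Finset.range (s + 1), (⇑derivative)^[j] q * G j l) * X ^ k) =
        m (q * v)) →
    ∀ i : Fin N, ∃ v : ℂ[X], ∀ q : ℂ[X], ∑ l, M l i (q * G s l) = m (q * v) := by
  intro s
  induction s with
  | zero =>
    intro G h i
    simpa using h 0 i
  | succ s ih =>
    intro G h i
    have hcomm : ∀ (q : ℂ[X]) (l : Fin N),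
        ∑ j ∈ Finset.range (s + 1), (⇑derivative)^[j] q * (((j : ℂ) + 1) • G (j + 1) l) =
        ∑ j ∈ Finset.range (s + 1 + 1), (⇑derivative)^[j] (X * q) * G j l -
          X * ∑ j ∈ Finset.range (s + 1 + 1), (⇑derivative)^[j] q * G j l := by
      intro q l
      rw [Finset.mul_sum, ← Finset.sum_sub_distrib]
      conv_rhs => rw [Finset.sum_range_succ']
      simp only [iterate_derivative_X_mul', Nat.add_sub_cancel]
      simp only [Function.iterate_zero, id_eq, Nat.cast_zero, zero_mul, add_zero]
      rw [mul_assoc, sub_self, add_zero]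
      refine Finset.sum_congr rfl fun j _ => ?_
      rw [smul_eq_C_mul]
      push_cast
      simp only [map_add, map_one, map_natCast]
      ring
    obtain ⟨v, hv⟩ := ih (fun j l => ((j : ℂ) + 1) • G (j + 1) l) (by
      intro k i
      obtain ⟨v₁, h₁⟩ := h k i
      obtain ⟨v₂, h₂⟩ := h (k + 1) i
      refine ⟨X * v₁ - v₂, fun q => ?_⟩
      have e : q * (X * v₁ - v₂) = X * q * v₁ - q * v₂ := by ring
      rw [e, map_sub, ← h₁, ← h₂, ← Finset.sum_sub_distrib]
      refine Finset.sum_congr rfl fun l _ => ?_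
      rw [hcomm, ← map_sub]
      congr 1
      ring) i
    have hs : ((s : ℂ) + 1) ≠ 0 := by exact_mod_cast Nat.succ_ne_zero s
    refine ⟨((s : ℂ) + 1)⁻¹ • v, fun q => ?_⟩
    rw [mul_smul_comm, map_smul, ← hv q]
    simp only [mul_smul_comm, map_smul, ← Finset.smul_sum]
    rw [inv_smul_smul₀ hs]

/-- A continuous function with all exponential moments `∫ e^{t|x|} |f(x)| dx` finite. -/
def HasExpMoments (f : ℝ → ℂ) : Prop :=
  Continuous f ∧ ∀ t : ℝ, Integrable fun x => Real.exp (t * |x|) * ‖f x‖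

namespace HasExpMoments

lemma mono {f g : ℝ → ℂ} (hg : HasExpMoments g) (hf : Continuous f) (c : ℝ)
    (h : ∀ x, ‖f x‖ ≤ Real.exp (c * |x|) * ‖g x‖) : HasExpMoments f := by
  refine ⟨hf, fun t => (hg.2 (t + c)).mono' (by fun_prop) (ae_of_all _ fun x => ?_)⟩
  rw [Real.norm_of_nonneg (by positivity), add_mul, Real.exp_add, mul_assoc]
  gcongr
  exact h x

lemma add {f g : ℝ → ℂ} (hf : HasExpMoments f) (hg : HasExpMoments g) :
    HasExpMoments fun x => f x + g x := by
  refine ⟨hf.1.add hg.1, fun t => ((hf.2 t).add (hg.2 t)).mono' ?_ (ae_of_all _ fun x => ?_)⟩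
  · have := hf.1
    have := hg.1
    fun_prop
  · rw [Real.norm_of_nonneg (by positivity), Pi.add_apply, ← mul_add]
    gcongr
    exact norm_add_le _ _

lemma const_mul {f : ℝ → ℂ} (hf : HasExpMoments f) (a : ℂ) : HasExpMoments fun x => a * f x := by
  refine ⟨continuous_const.mul hf.1, fun t => ((hf.2 t).const_mul ‖a‖).congr
    (ae_of_all _ fun x => ?_)⟩
  simp only [norm_mul]
  ring

lemma id_mul {f : ℝ → ℂ} (hf : HasExpMoments f) : HasExpMoments fun x => (x : ℂ) * f x := by
  have hc := hf.1
  refine hf.mono (by fun_prop) 1 fun x => ?_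
  rw [norm_mul, Complex.norm_real, Real.norm_eq_abs, one_mul]
  gcongr
  linarith [Real.add_one_le_exp |x|]

lemma poly_mul {f : ℝ → ℂ} (hf : HasExpMoments f) (q : ℂ[X]) :
    HasExpMoments fun x => q.eval (x : ℂ) * f x := by
  induction q using Polynomial.induction_on with
  | C a => simpa using hf.const_mul a
  | add p q hp hq => simpa [add_mul] using hp.add hq
  | monomial n a ih =>
    convert ih.id_mul using 2 with x
    simp only [eval_mul, eval_C, eval_pow, eval_X]
    ring

lemma integrable {f : ℝ → ℂ} (hf : HasExpMoments f) : Integrable f := by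
  have h := hf.2 0
  simp only [zero_mul, Real.exp_zero, one_mul] at h
  exact (integrable_norm_iff hf.1.aestronglyMeasurable).1 h

lemma sum {ι : Type*} (s : Finset ι) {f : ι → ℝ → ℂ} (hf : ∀ i ∈ s, HasExpMoments (f i)) :
    HasExpMoments fun x => ∑ i ∈ s, f i x := by
  classical
  induction s using Finset.induction_on with
  | empty => simpa [HasExpMoments] using continuous_const
  | insert a s ha ih =>
    simp only [Finset.sum_insert ha]
    exact (hf a (by simp)).add (ih fun i hi => hf i (by simp [hi]))

lemma gaussian (b : ℝ) : HasExpMoments fun x : ℝ =>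
    Complex.exp (-(x : ℂ) ^ 2 + 2 * (b : ℂ) * (x : ℂ)) := by
  refine ⟨by fun_prop, fun t => ?_⟩
  have h : ∀ c : ℝ, Integrable fun x : ℝ => Real.exp (-x ^ 2 + c * x) := fun c => by
    have := (integrable_cexp_quadratic (b := 1) (by simp) c 0).norm
    refine this.congr (ae_of_all _ fun x => ?_)
    simp only [Complex.norm_exp]
    congr 1
    simp [← Complex.ofReal_pow]
  refine ((h (t + 2 * b)).add (h (-t + 2 * b))).mono' (by fun_prop) (ae_of_all _ fun x => ?_)
  rw [Real.norm_of_nonneg (by positivity), Complex.norm_exp, ← Real.exp_add, Pi.add_apply]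
  have hre : (-(x : ℂ) ^ 2 + 2 * (b : ℂ) * (x : ℂ)).re = -x ^ 2 + 2 * b * x := by
    simp [← Complex.ofReal_pow]
  rw [hre]
  rcases abs_cases x with ⟨h1, _⟩ | ⟨h1, _⟩
  · rw [h1]
    refine le_trans (le_of_eq ?_) (le_add_of_nonneg_right (Real.exp_pos _).le)
    ring_nf
  · rw [h1]
    refine le_trans (le_of_eq ?_) (le_add_of_nonneg_left (Real.exp_pos _).le)
    ring_nf

/-- Injectivity of the moment map on functions with exponential moments. -/
lemma eq_zero_of_moments {f : ℝ → ℂ} (hf : HasExpMoments f)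
    (h : ∀ n : ℕ, ∫ x : ℝ, (x : ℂ) ^ n * f x = 0) : f = 0 := by
  have hF : FourierTransform.fourier f = 0 := by
    ext v
    rw [Real.fourier_real_eq_integral_exp_smul]
    set z : ℂ := ((-2 * Real.pi * v : ℝ) : ℂ) * Complex.I with hz
    have hs : HasSum (fun n : ℕ => ∫ x : ℝ, (z * x) ^ n / (n.factorial : ℂ) * f x)
        (∫ x : ℝ, Complex.exp (z * x) * f x) := by
      have hexp : ∀ x : ℝ, HasSum (fun n : ℕ => ‖z * x‖ ^ n / (n.factorial : ℝ) * ‖f x‖)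
          (Real.exp (‖z‖ * |x|) * ‖f x‖) := fun x => by
        have := (NormedSpace.expSeries_div_hasSum_exp (‖z‖ * |x|)).mul_right ‖f x‖
        rw [← Real.exp_eq_exp_ℝ] at this
        simpa [norm_mul] using this
      have hc := hf.1
      refine hasSum_integral_of_dominated_convergence
        (fun n x => ‖z * x‖ ^ n / (n.factorial : ℝ) * ‖f x‖) (fun n => by fun_prop)
        (fun n => ae_of_all _ fun x => by simp) (ae_of_all _ fun x => (hexp x).summable) ?_
        (ae_of_all _ fun x => ?_)
      · refine (hf.2 ‖z‖).congr (ae_of_all _ fun x => (hexp x).tsum_eq.symm)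
      · have := (NormedSpace.expSeries_div_hasSum_exp (z * x)).mul_right (f x)
        rwa [← Complex.exp_eq_exp_ℂ] at this
    have h0 : ∀ n : ℕ, ∫ x : ℝ, (z * x) ^ n / (n.factorial : ℂ) * f x = 0 := fun n => by
      have : ∀ x : ℝ, (z * x) ^ n / (n.factorial : ℂ) * f x =
          z ^ n / (n.factorial : ℂ) * ((x : ℂ) ^ n * f x) := fun x => by
        rw [mul_pow]; ring
      simp_rw [this]
      rw [integral_const_mul, h n, mul_zero]
    simp only [h0] at hs
    have he := hs.unique hasSum_zero
    rw [Pi.zero_apply, ← he]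
    refine integral_congr_ae (ae_of_all _ fun x => ?_)
    simp only [smul_eq_mul, hz]
    congr 2
    push_cast
    ring
  have hinv := hf.1.fourierInv_fourier_eq hf.integrable (by rw [hF]; exact integrable_zero _ _ _)
  rw [← hinv, hF]
  ext v
  simp [Real.fourierInv_eq]

lemma of_even_moments_le {h : ℝ → ℝ} (hc : Continuous h) (h0 : ∀ x, 0 ≤ h x)
    (hint : ∀ n : ℕ, Integrable fun x : ℝ => x ^ n * h x) {g : ℝ → ℂ} (hg : HasExpMoments g)
    (hle : ∀ n : ℕ, ∫ x : ℝ, x ^ (2 * n) * h x ≤ ∫ x : ℝ, x ^ (2 * n) * ‖g x‖) :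
    HasExpMoments fun x => (h x : ℂ) := by
  have hgc := hg.1
  have hgint : ∀ n : ℕ, Integrable fun x : ℝ => x ^ (2 * n) * ‖g x‖ := fun n => by
    refine ((hg.poly_mul (X ^ (2 * n))).integrable.norm).congr (ae_of_all _ fun x => ?_)
    simp [pow_mul]
  have hseries : ∀ (k : ℝ → ℝ), Continuous k → (∀ x, 0 ≤ k x) → ∀ t : ℝ,
      ∫⁻ x : ℝ, ENNReal.ofReal (Real.cosh (t * x) * k x) =
      ∑' n : ℕ, ∫⁻ x : ℝ, ENNReal.ofReal (t ^ (2 * n) / ((2 * n).factorial : ℝ)) *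
        ENNReal.ofReal (x ^ (2 * n) * k x) := by
    intro k hk hk0 t
    rw [← lintegral_tsum (fun n => by fun_prop)]
    refine lintegral_congr fun x => ?_
    have hs := (Real.hasSum_cosh (t * x)).mul_right (k x)
    rw [← hs.tsum_eq, ENNReal.ofReal_tsum_of_nonneg (fun n => ?_) hs.summable]
    · refine tsum_congr fun n => ?_
      rw [← ENNReal.ofReal_mul (by rw [pow_mul]; positivity)]
      congr 1
      rw [mul_pow]; ring
    · rw [pow_mul]; have := hk0 x; positivity
  refine ⟨by fun_prop, fun t => ?_⟩
  have hcosh : Integrable fun x : ℝ => Real.cosh (t * x) * h x := by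
    refine ⟨by fun_prop, ?_⟩
    rw [hasFiniteIntegral_iff_ofReal (ae_of_all _ fun x =>
      mul_nonneg (Real.cosh_pos _).le (h0 x)), hseries h hc h0 t]
    have hgfin : ∫⁻ x : ℝ, ENNReal.ofReal (Real.cosh (t * x) * ‖g x‖) < ⊤ := by
      have hI : Integrable fun x : ℝ => Real.cosh (t * x) * ‖g x‖ := by
        refine (hg.2 |t|).mono' (by fun_prop) (ae_of_all _ fun x => ?_)
        rw [Real.norm_of_nonneg (mul_nonneg (Real.cosh_pos _).le (norm_nonneg _))]
        gcongr
        rw [← abs_mul, ← Real.cosh_abs, Real.cosh_eq]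
        have : Real.exp (-|t * x|) ≤ Real.exp |t * x| :=
          Real.exp_le_exp.2 (by linarith [abs_nonneg (t * x)])
        linarith
      exact (hasFiniteIntegral_iff_ofReal (ae_of_all _ fun x =>
        mul_nonneg (Real.cosh_pos _).le (norm_nonneg _))).1 hI.2
    rw [hseries (fun x => ‖g x‖) (by fun_prop) (fun x => norm_nonneg _) t] at hgfin
    refine lt_of_le_of_lt (ENNReal.tsum_le_tsum fun n => ?_) hgfin
    rw [lintegral_const_mul _ (by fun_prop), lintegral_const_mul _ (by fun_prop)]
    refine mul_le_mul' le_rfl ?_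
    rw [← ofReal_integral_eq_lintegral_ofReal (hint _) (ae_of_all _ fun x => by
        have := h0 x; simp only [pow_mul, Pi.zero_apply]; positivity),
      ← ofReal_integral_eq_lintegral_ofReal (hgint _) (ae_of_all _ fun x => by
        simp only [pow_mul, Pi.zero_apply]; positivity)]
    exact ENNReal.ofReal_le_ofReal (hle n)
  refine (hcosh.const_mul 2).mono' (by fun_prop) (ae_of_all _ fun x => ?_)
  have hx := h0 x
  rw [Real.norm_of_nonneg (by positivity), Complex.norm_real, Real.norm_of_nonneg hx, ← mul_assoc]
  gcongr
  rw [Real.cosh_eq]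
  rcases abs_cases x with ⟨h1, _⟩ | ⟨h1, _⟩ <;> rw [h1]
  · linarith [Real.exp_pos (-(t * x))]
  · rw [mul_neg]
    linarith [Real.exp_pos (t * x)]

end HasExpMoments

lemma dense_setOf_eval_ne_zero {v : ℂ[X]} (hv : v ≠ 0) :
    Dense {x : ℝ | v.eval (x : ℂ) ≠ 0} := by
  have hfin : {x : ℝ | v.eval (x : ℂ) = 0}.Finite := by
    have := (v.finite_setOfPred_isRoot hv).preimage (f := fun x : ℝ => (x : ℂ))
      (Complex.ofReal_injective.injOn)
    exact this
  exact hfin.countable.dense_compl ℝ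

lemma eval_map_conj (q : ℂ[X]) (x : ℝ) :
    (q.map (starRingEnd ℂ)).eval (x : ℂ) = starRingEnd ℂ (q.eval (x : ℂ)) := by
  have := Polynomial.eval_map_apply (f := starRingEnd ℂ) (p := q) (x : ℂ)
  rwa [Complex.conj_ofReal] at this

/-- Determinacy: a polynomial multiple of a nonnegative density which has the moments of a
function with exponential moments coincides with that function. -/
lemma eq_of_moments_eq {u : ℝ → ℝ} (hu : Continuous u) (hu0 : ∀ x, 0 ≤ u x)
    (hint : ∀ q : ℂ[X], Integrable fun x : ℝ => q.eval (x : ℂ) * (u x : ℂ))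
    {R : ℝ → ℂ} (hR : HasExpMoments R) (v : ℂ[X])
    (hm : ∀ q : ℂ[X], ∫ x : ℝ, q.eval (x : ℂ) * R x =
      ∫ x : ℝ, (q * v).eval (x : ℂ) * (u x : ℂ)) (x : ℝ) :
    R x = v.eval (x : ℂ) * u x := by
  rcases eq_or_ne v 0 with rfl | hv
  · have := hR.eq_zero_of_moments fun n => by simpa using hm (X ^ n)
    simp [this]
  set v' := v.map (starRingEnd ℂ) with hv'
  have hvv : ∀ x : ℝ, v'.eval (x : ℂ) * v.eval (x : ℂ) = ((‖v.eval (x : ℂ)‖ ^ 2 : ℝ) : ℂ) := by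
    intro x
    rw [hv', eval_map_conj, mul_comm, Complex.mul_conj, Complex.normSq_eq_norm_sq]
  have hmom : ∀ n : ℕ, ∫ x : ℝ, (x : ℂ) ^ n * (v'.eval (x : ℂ) * R x) =
      ∫ x : ℝ, (x : ℂ) ^ n * ((‖v.eval (x : ℂ)‖ ^ 2 * u x : ℝ) : ℂ) := by
    intro n
    have := hm (X ^ n * v')
    simp only [eval_mul, eval_pow, eval_X, mul_assoc] at this
    rw [this]
    refine integral_congr_ae (ae_of_all _ fun x => ?_)
    simp only
    rw [Complex.ofReal_mul, ← hvv, mul_assoc]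
  have hint' : ∀ n : ℕ, Integrable fun x : ℝ => x ^ n * (‖v.eval (x : ℂ)‖ ^ 2 * u x) := by
    intro n
    refine (hint (X ^ n * v' * v)).re.congr (ae_of_all _ fun x => ?_)
    simp only [eval_mul, eval_pow, eval_X, mul_assoc (_ ^ n), hvv]
    simp only [← Complex.ofReal_pow, ← Complex.ofReal_mul, RCLike.re_to_complex, Complex.ofReal_re]
  have hg := hR.poly_mul v'
  have hh : HasExpMoments fun x => ((‖v.eval (x : ℂ)‖ ^ 2 * u x : ℝ) : ℂ) := by
    refine HasExpMoments.of_even_moments_le (by fun_prop)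
      (fun x => mul_nonneg (by positivity) (hu0 x)) hint' hg fun n => ?_
    have h1 : ((∫ x : ℝ, x ^ (2 * n) * (‖v.eval (x : ℂ)‖ ^ 2 * u x) : ℝ) : ℂ) =
        ∫ x : ℝ, (x : ℂ) ^ (2 * n) * (v'.eval (x : ℂ) * R x) := by
      rw [hmom, ← integral_complex_ofReal]
      refine integral_congr_ae (ae_of_all _ fun x => ?_)
      push_cast
      ring
    refine (le_abs_self _).trans ?_
    rw [← Real.norm_eq_abs, ← Complex.norm_real, h1]
    refine (norm_integral_le_integral_norm _).trans (le_of_eq ?_)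
    refine integral_congr_ae (ae_of_all _ fun x => ?_)
    simp [pow_mul]
  have hz := (hg.add (hh.const_mul (-1))).eq_zero_of_moments fun n => by
    have i1 := (hg.poly_mul (X ^ n)).integrable
    have i2 := ((hh.const_mul (-1)).poly_mul (X ^ n)).integrable
    simp only [eval_pow, eval_X] at i1 i2
    simp only [mul_add]
    rw [integral_add i1 i2, hmom]
    simp only [mul_left_comm _ (-1 : ℂ)]
    rw [integral_const_mul]
    ring
  have hoff : ∀ x ∈ {x : ℝ | v.eval (x : ℂ) ≠ 0}, R x = v.eval (x : ℂ) * u x := by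
    intro x hx
    have h1 := congrFun hz x
    simp only [Pi.zero_apply] at h1
    rw [Complex.ofReal_mul, ← hvv] at h1
    have hv'x : v'.eval (x : ℂ) ≠ 0 := by
      rw [hv', eval_map_conj]
      simpa using hx
    refine mul_left_cancel₀ hv'x ?_
    linear_combination h1
  exact congrFun (Continuous.ext_on (dense_setOf_eval_ne_zero hv) hR.1 (by fun_prop) hoff) x

/-- The linear functional `q ↦ ∫ q φ`. -/
def momentMap (φ : ℝ → ℂ) (h : ∀ q : ℂ[X], Integrable fun x : ℝ => q.eval (x : ℂ) * φ x) :
    ℂ[X] →ₗ[ℂ] ℂ where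
  toFun q := ∫ x : ℝ, q.eval (x : ℂ) * φ x
  map_add' p q := by
    rw [← integral_add (h p) (h q)]
    simp only [eval_add, add_mul]
  map_smul' c q := by
    simp only [eval_smul, smul_eq_mul, mul_assoc, RingHom.id_apply]
    exact integral_const_mul _ _

lemma momentMap_apply (φ : ℝ → ℂ)
    (h : ∀ q : ℂ[X], Integrable fun x : ℝ => q.eval (x : ℂ) * φ x) (q : ℂ[X]) :
    momentMap φ h q = ∫ x : ℝ, q.eval (x : ℂ) * φ x := rfl

lemma innerW_apply_eq_momentMap {N r s : ℕ} (W : ℝ → Matrix (Fin N) (Fin N) ℂ)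
    (h : ∀ i j (q : ℂ[X]), Integrable fun x : ℝ => q.eval (x : ℂ) * W x i j)
    (P : MatPoly r N) (Q : MatPoly s N) (i : Fin r) (j : Fin s) :
    innerW Set.univ W P Q i j =
      ∑ k, ∑ l, momentMap (fun x => W x k l) (h k l) (P i k * conjP (Q j l)) := by
  simp only [innerW, Matrix.of_apply, momentMap_apply, Measure.restrict_univ]
  have hsum : ∀ k, ∑ l, ∫ x : ℝ, (P i k * conjP (Q j l)).eval (x : ℂ) * W x k l =
      ∫ x : ℝ, ∑ l, (P i k * conjP (Q j l)).eval (x : ℂ) * W x k l := fun k =>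
    (integral_finsetSum _ fun l _ => h k l _).symm
  simp only [hsum]
  rw [← integral_finsetSum _ fun k _ => integrable_finsetSum _ fun l _ => h k l _]
  refine integral_congr_ae (ae_of_all _ fun x => ?_)
  simp only [Matrix.mul_apply, evalM, Matrix.of_apply, Matrix.conjTranspose_apply, eval_mul,
    conjP, eval_map_conj, Finset.sum_mul]
  rw [Finset.sum_comm]
  refine Finset.sum_congr rfl fun k _ => Finset.sum_congr rfl fun l _ => ?_
  simp only [RCLike.star_def]
  ring

lemma hermW_hasExpMoments (a b c : ℝ) (i j : Fin 3) :
    HasExpMoments fun x => hermW a b c x i j := by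
  have e : (fun x => hermW a b c x i j) = fun x : ℝ =>
      (if i = 0 ∧ j = 0 then 1 else 0) * Complex.exp (-(x : ℂ) ^ 2 + 2 * (b : ℂ) * (x : ℂ)) +
      ((!![C (a : ℂ) ^ 2 * X ^ 2, C (a : ℂ) * X, C (a : ℂ) * C (c : ℂ) * X ^ 2;
          C (a : ℂ) * X, 1, C (c : ℂ) * X;
          C (a : ℂ) * C (c : ℂ) * X ^ 2, C (c : ℂ) * X, C (c : ℂ) ^ 2 * X ^ 2 + 1] :
          Matrix (Fin 3) (Fin 3) ℂ[X]) i j).eval (x : ℂ) *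
        Complex.exp (-(x : ℂ) ^ 2 + 2 * ((0 : ℝ) : ℂ) * (x : ℂ)) := by
    funext x
    fin_cases i <;> fin_cases j <;> simp [hermW, Complex.exp_add] <;> ring
  rw [e]
  exact ((HasExpMoments.gaussian b).const_mul _).add ((HasExpMoments.gaussian 0).poly_mul _)

/-- If `F W` is a polynomial multiple of `w`, where neither `e^{-x²} / w` nor
`e^{-x² + 2bx} / w` is rational, then `F = 0`. -/
lemma row_eq_zero_of_mul_hermW_eq (a b c : ℝ) (w : ℝ → ℂ) (F v : Fin 3 → ℂ[X])
    (hrat1 : ¬ CoincidesRational fun x : ℝ => Complex.exp (-(x : ℂ) ^ 2) * (w x)⁻¹)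
    (hrat2 : ¬ CoincidesRational fun x : ℝ =>
      Complex.exp (-(x : ℂ) ^ 2 + 2 * (b : ℂ) * (x : ℂ)) * (w x)⁻¹)
    (h : ∀ i (x : ℝ), ∑ l, (F l).eval (x : ℂ) * hermW a b c x l i = (v i).eval (x : ℂ) * w x) :
    ∀ l, F l = 0 := by
  have hexp : ∀ (g : ℝ → ℂ), (∀ x, g x ≠ 0) →
      (¬ CoincidesRational fun x : ℝ => g x * (w x)⁻¹) → ∀ r s : ℂ[X],
      (∀ x : ℝ, r.eval (x : ℂ) * g x = s.eval (x : ℂ) * w x) → r = 0 := by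
    intro g hg hrat r s hrs
    by_contra hr
    refine hrat ⟨s, r, hr, fun x hx => ?_⟩
    have hwx : w x ≠ 0 := fun h0 => by
      have := hrs x
      rw [h0, mul_zero] at this
      exact mul_ne_zero hx (hg x) this
    change g x * (w x)⁻¹ = _
    rw [eq_div_iff hx, ← div_eq_mul_inv, div_mul_eq_mul_div, div_eq_iff hwx]
    linear_combination hrs x
  have h2 := hexp (fun x => Complex.exp (-(x : ℂ) ^ 2)) (fun x => Complex.exp_ne_zero _) hrat1
    (F 0 * (C (a : ℂ) * X) + F 1 + F 2 * (C (c : ℂ) * X)) (v 1) fun x => by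
      rw [← h 1 x]
      simp [Fin.sum_univ_three, hermW]
      ring
  have h3 := hexp (fun x => Complex.exp (-(x : ℂ) ^ 2)) (fun x => Complex.exp_ne_zero _) hrat1
    (F 0 * (C (a : ℂ) * C (c : ℂ) * X ^ 2) + F 1 * (C (c : ℂ) * X) +
      F 2 * (C (c : ℂ) ^ 2 * X ^ 2 + 1)) (v 2) fun x => by
      rw [← h 2 x]
      simp [Fin.sum_univ_three, hermW]
      ring
  have hF2 : F 2 = 0 := by linear_combination h3 - C (c : ℂ) * X * h2
  have hF1 : F 1 = - (F 0 * (C (a : ℂ) * X)) := by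
    linear_combination h2 - C (c : ℂ) * X * hF2
  have hF0 := hexp _ (fun x => Complex.exp_ne_zero _) hrat2 (F 0) (v 0) fun x => by
      rw [← h 0 x]
      simp [Fin.sum_univ_three, hermW, hF1, hF2, Complex.exp_add]
      ring
  intro l
  fin_cases l
  · exact hF0
  · simp [hF1, hF0]
  · exact hF2

lemma integrable_eval_mul_of_moments {φ : ℝ → ℂ}
    (h : ∀ k : ℕ, Integrable fun x : ℝ => (x : ℂ) ^ k * φ x) (q : ℂ[X]) :
    Integrable fun x : ℝ => q.eval (x : ℂ) * φ x := by
  simp only [Polynomial.eval_eq_sum_range, Finset.sum_mul, mul_assoc]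
  exact integrable_finsetSum _ fun k _ => (h k).const_mul _

/-- A scalar weight on `ℝ` is real and nonnegative everywhere. -/
lemma IsWeight.eq_norm {w : ℝ → Matrix (Fin 1) (Fin 1) ℂ} (hw : IsWeight Set.univ w) (x : ℝ) :
    w x 0 0 = ((‖w x 0 0‖ : ℝ) : ℂ) := by
  have hc : Continuous fun x => w x 0 0 := (contDiffOn_univ.1 (hw.smooth 0 0)).continuous
  have hae : (fun x => w x 0 0) =ᵐ[volume] fun x => ((‖w x 0 0‖ : ℝ) : ℂ) := by
    have := hw.posdef
    rw [Measure.restrict_univ] at this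
    filter_upwards [this] with x hx
    exact (Complex.norm_of_nonneg' hx.diag_pos.le).symm
  exact congrFun ((Continuous.ae_eq_iff_eq volume hc (by fun_prop)).1 hae) x

lemma IsWeight.momentMap_mul_conj_ne_zero {w : ℝ → Matrix (Fin 1) (Fin 1) ℂ}
    (hw : IsWeight Set.univ w)
    (hint : ∀ q : ℂ[X], Integrable fun x : ℝ => q.eval (x : ℂ) * w x 0 0) {q : ℂ[X]}
    (hq : q ≠ 0) : momentMap (fun x => w x 0 0) hint (q * conjP q) ≠ 0 := by
  have hpt : ∀ x : ℝ, (q * conjP q).eval (x : ℂ) * w x 0 0 =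
      ((‖q.eval (x : ℂ)‖ ^ 2 * ‖w x 0 0‖ : ℝ) : ℂ) := fun x => by
    rw [hw.eq_norm x, eval_mul, conjP, eval_map_conj, Complex.mul_conj, Complex.normSq_eq_norm_sq]
    simp
  have hc : Continuous fun x => w x 0 0 := (contDiffOn_univ.1 (hw.smooth 0 0)).continuous
  have hi : Integrable fun x : ℝ => ‖q.eval (x : ℂ)‖ ^ 2 * ‖w x 0 0‖ := by
    refine (hint (q * conjP q)).norm.congr (ae_of_all _ fun x => ?_)
    simp only [hpt, Complex.norm_real]
    exact Real.norm_of_nonneg (by positivity)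
  rw [momentMap_apply]
  simp only [hpt]
  rw [integral_complex_ofReal, Ne, Complex.ofReal_eq_zero,
    integral_eq_zero_iff_of_nonneg (fun x => by positivity) hi]
  intro h0
  have h1 := (Continuous.ae_eq_iff_eq volume (by fun_prop) continuous_zero).1 h0
  have h2 : (fun x => w x 0 0) = fun _ => 0 := by
    refine Continuous.ext_on (dense_setOf_eval_ne_zero hq) hc continuous_const fun x hx => ?_
    have := congrFun h1 x
    simpa [show q.eval (x : ℂ) ≠ 0 from hx] using this
  have h3 := hw.posdef
  rw [Measure.restrict_univ] at h3
  obtain ⟨x, hx⟩ := h3.exists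
  exact hx.diag_pos.ne' (congrFun h2 x)

/-- vanishing of the module `𝒟(w, W)` for the 3×3 Hermite-type weight. -/
theorem statement_19 (a b c : ℝ) (ha : a ≠ 0) (hb : b ≠ 0) (hc : c ≠ 0)
    (P : ℕ → MatPoly 3 3) (hP : IsMOP Set.univ (hermW a b c) P)
    (w : ℝ → Matrix (Fin 1) (Fin 1) ℂ)
    (hw : IsWeight Set.univ w) (hwgood : GoodEnough Set.univ w)
    (p : ℕ → MatPoly 1 1) (hp : IsMOP Set.univ w p)
    (hrat1 : ¬ CoincidesRational fun x : ℝ => Complex.exp (-(x : ℂ) ^ 2) * (w x 0 0)⁻¹)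
    (hrat2 : ¬ CoincidesRational fun x : ℝ =>
      Complex.exp (-(x : ℂ) ^ 2 + 2 * (b : ℂ) * (x : ℂ)) * (w x 0 0)⁻¹) :
    ∀ T : MatDiffOp 1 3,
      (∀ n, ∃ A : Matrix (Fin 1) (Fin 3) ℂ, MatDiffOp.act (p n) T = cmap A * P n) →
      ∀ j, T.coeff j = 0 := by
  have hWint : ∀ i j (q : ℂ[X]), Integrable fun x : ℝ => q.eval (x : ℂ) * hermW a b c x i j :=
    fun i j q => ((hermW_hasExpMoments a b c i j).poly_mul q).integrable
  have hwint : ∀ q : ℂ[X], Integrable fun x : ℝ => q.eval (x : ℂ) * w x 0 0 :=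
    integrable_eval_mul_of_moments fun k => by
      simpa using hw.moments k 0 0
  set M : Fin 3 → Fin 3 → (ℂ[X] →ₗ[ℂ] ℂ) := fun i j =>
    momentMap (fun x => hermW a b c x i j) (hWint i j) with hM
  set m := momentMap (fun x => w x 0 0) hwint with hm
  have hPorth := mop_orthogonal_of_degree_lt M P hP.degree_le hP.lead_unit fun n k hnk i j => by
    rw [hM, ← innerW_apply_eq_momentMap (hermW a b c) hWint, hP.orthogonal n k hnk]
    rfl
  have hpdeg : ∀ n, (p n 0 0).natDegree ≤ n := fun n => hp.degree_le n 0 0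
  have hplead : ∀ n, (p n 0 0).coeff n ≠ 0 := fun n => by
    have := (Matrix.isUnit_iff_isUnit_det _).1 (hp.lead_unit n)
    simpa using this
  have hporth : ∀ n k, n ≠ k → m (p n 0 0 * conjP (p k 0 0)) = 0 := fun n k hnk => by
    have h1 := innerW_apply_eq_momentMap w (fun i j q => by
      rw [Subsingleton.elim i 0, Subsingleton.elim j 0]; exact hwint q) (p n) (p k) 0 0
    rw [hp.orthogonal n k hnk] at h1
    simpa [hm] using h1.symm
  have hppos : ∀ n, m (p n 0 0 * conjP (p n 0 0)) ≠ 0 := fun n =>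
    hw.momentMap_mul_conj_ne_zero hwint fun h0 => hplead n (by simp [h0])
  intro T hT
  have hact : ∀ n l, ∑ j ∈ Finset.range (T.order + 1),
      (⇑derivative)^[j] (p n 0 0) * T.coeff j 0 l = MatDiffOp.act (p n) T 0 l := fun n l => by
    simp [MatDiffOp.act, Matrix.sum_apply, Matrix.mul_apply, derivM]
  have hadj : ∀ (k : ℕ) (i : Fin 3), ∃ v : ℂ[X], ∀ q : ℂ[X],
      ∑ l, M l i ((∑ j ∈ Finset.range (T.order + 1),
        (⇑derivative)^[j] q * T.coeff j 0 l) * X ^ k) = m (q * v) := by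
    intro k i
    set L : ℂ[X] →ₗ[ℂ] ℂ := ∑ l, M l i ∘ₗ LinearMap.mulRight ℂ (X ^ k) ∘ₗ
      ∑ j ∈ Finset.range (T.order + 1),
        LinearMap.mulRight ℂ (T.coeff j 0 l) ∘ₗ (derivative ^ j) with hL
    have hLapp : ∀ q, L q = ∑ l, M l i ((∑ j ∈ Finset.range (T.order + 1),
        (⇑derivative)^[j] q * T.coeff j 0 l) * X ^ k) := fun q => by
      simp [hL, Module.End.pow_apply, Finset.sum_mul]
    obtain ⟨v, hv⟩ := exists_representing_polynomial m (fun n => p n 0 0) hpdeg hplead hporth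
      hppos (k + 1) L (by
        intro n hn
        obtain ⟨A, hA⟩ := hT n
        simp only [hLapp, hact, hA, cmap, Matrix.mul_apply, Matrix.map_apply, Finset.sum_mul,
          map_sum]
        rw [Finset.sum_comm]
        refine Finset.sum_eq_zero fun r _ => ?_
        have h0 := hPorth n (k + 1) hn (Matrix.of fun i j => if i = j then X ^ k else 0)
          (fun i j => by
            simp only [Matrix.of_apply]
            split_ifs
            · rw [degree_X_pow]; exact_mod_cast Nat.lt_succ_self k
            · simp) r i
        have h1 : ∀ l, M l i (C (A 0 r) * P n r l * X ^ k) =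
            A 0 r * M l i (P n r l * X ^ k) := fun l => by
          rw [mul_assoc, ← smul_eq_C_mul, map_smul, smul_eq_mul]
        simp only [h1, ← Finset.mul_sum]
        refine mul_eq_zero_of_right _ ?_
        rw [← h0]
        refine Finset.sum_congr rfl fun l _ => ?_
        rw [Finset.sum_eq_single i (fun s _ hs => by simp [conjP, hs.symm]) (by simp)]
        simp [conjP])
    exact ⟨v, fun q => by rw [← hLapp, hv]⟩
  have hvanish : ∀ d j, T.order < j + d → T.coeff j = 0 := by
    intro d
    induction d with
    | zero => exact fun j hj => T.coeff_eq_zero j hj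
    | succ d ih =>
      intro j hj
      rcases lt_or_ge T.order j with hlt | hle
      · exact T.coeff_eq_zero j hlt
      have hhigh : ∀ r, j < r → T.coeff r = 0 := fun r hr => ih r (by omega)
      have htop := leading_coeff_adjointable M m j (fun r l => T.coeff r 0 l) (by
        intro k i
        obtain ⟨v, hv⟩ := hadj k i
        refine ⟨v, fun q => ?_⟩
        rw [← hv q]
        refine Finset.sum_congr rfl fun l _ => ?_
        congr 2
        refine Finset.sum_subset (Finset.range_mono (by omega)) fun r _ hr => ?_
        rw [hhigh r (by simpa using hr)]
        simp)
      choose v hv using htop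
      have hrow := row_eq_zero_of_mul_hermW_eq a b c (fun x => w x 0 0)
        (fun l => T.coeff j 0 l) v hrat1 hrat2 (by
          intro i x
          rw [hw.eq_norm x]
          have hc : Continuous fun x => w x 0 0 := (contDiffOn_univ.1 (hw.smooth 0 0)).continuous
          refine eq_of_moments_eq (u := fun x => ‖w x 0 0‖) (by fun_prop)
            (fun x => norm_nonneg _) (fun q => ?_)
            (R := fun x => ∑ l, (T.coeff j 0 l).eval (x : ℂ) * hermW a b c x l i)
            (HasExpMoments.sum _ fun l _ => (hermW_hasExpMoments a b c l i).poly_mul _)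
            (v i) (fun q => ?_) x
          · simp only [← hw.eq_norm]
            exact hwint q
          · simp only [← hw.eq_norm]
            have := hv i q
            simp only [hM, hm, momentMap_apply] at this
            rw [← this, ← integral_finsetSum _ fun l _ => hWint l i _]
            simp only [eval_mul, Finset.mul_sum, mul_assoc])
      ext i l : 2
      rw [Subsingleton.elim i 0, hrow l]
      rfl
  exact fun j => hvanish (T.order + 1) j (by omega)
end
end
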